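/- arXiv:2509.23734 — 5 statements merged into one kernel-verified Lean document; each statement's English description precedes it below -/
import Mathlib

section
/- Let H be a complex Hilbert space, and let M and N be von Neumann algebras on H such that M ⊆ N′ and M′ ∩ N′ = ℂ·1 (every bounded operator commuting with both M and N is a scalar multiple of the identity). Let Ω ∈ H be a unit vector, and let P ∈ M and Q ∈ N be orthogonal projections with PΩ = Ω = QΩ. Assume: (i) the closure of the set { PQ a QP Ω + i PQ b QP Ω : a ∈ M_h, b ∈ N_h } equals the range of the projection PQ; and (ii) the range of Q equals the closure of MΩ. Then M = N′. -/
open scoped ComplexStarModule in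
theorem VonNeumannAlgebra.linearMap_eq_zero_of_selfAdjoint
    {H : Type*} [NormedAddCommGroup H] [InnerProductSpace ℂ H] [CompleteSpace H]
    (V : VonNeumannAlgebra H) (f : (H →L[ℂ] H) →ₗ[ℂ] ℂ)
    (h : ∀ x ∈ V, IsSelfAdjoint x → f x = 0) {x : H →L[ℂ] H} (hx : x ∈ V) : f x = 0 := by
  have hsmul : ∀ (r : ℂ) {y : H →L[ℂ] H}, y ∈ V → r • y ∈ V := fun r y hy =>
    V.toStarSubalgebra.smul_mem hy r
  have hsmul' : ∀ (r : ℝ) {y : H →L[ℂ] H}, y ∈ V → r • y ∈ V := fun r y hy => by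
    simpa using hsmul (r : ℂ) hy
  have hre : (ℜ x : H →L[ℂ] H) ∈ V := by
    rw [realPart_apply_coe]
    exact hsmul' _ (add_mem hx (star_mem hx))
  have him : (ℑ x : H →L[ℂ] H) ∈ V := by
    rw [imaginaryPart_apply_coe]
    exact hsmul _ (hsmul' _ (sub_mem hx (star_mem hx)))
  rw [← realPart_add_I_smul_imaginaryPart x, map_add, map_smul, h _ hre (ℜ x).2,
    h _ him (ℑ x).2, smul_zero, add_zero]

/-- If `I • t` is a limit of vectors `u + I • v` with `⟪u, v⟫`, `⟪u, t⟫` and `⟪w, v⟫` real, then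
`⟪w, t⟫` is real. -/
theorem inner_im_eq_zero_of_mem_closure
    {H : Type*} [NormedAddCommGroup H] [InnerProductSpace ℂ H] {S : Set H} {t w : H}
    (ht : Complex.I • t ∈ closure S)
    (hS : ∀ x ∈ S, ∃ u v : H, x = u + Complex.I • v ∧ (inner ℂ u v).im = 0 ∧
      (inner ℂ u t).im = 0 ∧ (inner ℂ w v).im = 0) :
    (inner ℂ w t).im = 0 := by
  have hbound : ∀ ε > 0, |(inner ℂ w t).im| ≤ ‖w‖ * ε := by
    intro ε hε
    obtain ⟨x, hx, hdist⟩ := Metric.mem_closure_iff.1 ht ε hε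
    obtain ⟨u, v, rfl, huv, hut, hwv⟩ := hS x hx
    have hpyth : ‖Complex.I • (t - v) - u‖ ^ 2 = ‖t - v‖ ^ 2 + ‖u‖ ^ 2 := by
      rw [norm_sub_sq (𝕜 := ℂ), inner_re_symm (𝕜 := ℂ), inner_smul_right, inner_sub_right, norm_smul]
      simp [huv, hut]
    have hle : ‖t - v‖ ≤ ε := by
      have h1 : ‖Complex.I • (t - v) - u‖ < ε := by
        rw [dist_eq_norm] at hdist
        rwa [smul_sub, sub_sub, add_comm (Complex.I • v)]
      nlinarith [norm_nonneg (t - v), norm_nonneg (Complex.I • (t - v) - u), sq_nonneg ‖u‖]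
    calc |(inner ℂ w t).im| = |(inner ℂ w (t - v)).im| := by simp [hwv]
      _ ≤ ‖inner ℂ w (t - v)‖ := Complex.abs_im_le_norm _
      _ ≤ ‖w‖ * ‖t - v‖ := norm_inner_le_norm _ _
      _ ≤ ‖w‖ * ε := by gcongr
  by_contra hne
  have hpos : 0 < |(inner ℂ w t).im| := abs_pos.2 hne
  have h := hbound (|(inner ℂ w t).im| / (2 * (‖w‖ + 1))) (by positivity)
  have hw := norm_nonneg w
  rw [mul_div_assoc', le_div_iff₀ (by positivity)] at h
  nlinarith

theorem IsSelfAdjoint.inner_im_eq_zero_of_commute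
    {H : Type*} [NormedAddCommGroup H] [InnerProductSpace ℂ H] [CompleteSpace H]
    {x y : H →L[ℂ] H} (hx : IsSelfAdjoint x) (hy : IsSelfAdjoint y) (hxy : x * y = y * x)
    (ξ : H) : (inner ℂ (x ξ) (y ξ)).im = 0 := by
  have h : inner ℂ (x ξ) (y ξ) = inner ℂ (y ξ) (x ξ) := by
    rw [hx.isSymmetric.apply_clm, hy.isSymmetric.apply_clm]
    exact congrArg (inner ℂ ξ) (DFunLike.congr_fun hxy ξ)
  rw [← inner_conj_symm (y ξ)] at h
  exact Complex.conj_eq_iff_im.1 h.symm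


/-- **A sufficient condition for Haag duality** (abstract form).
Let `H` be a complex Hilbert space, `M` and `N` von Neumann algebras on `H` with `M ⊆ N′`
and `M′ ∩ N′ = ℂ·1`.  Let `Ω` be a unit vector and `P ∈ M`, `Q ∈ N` orthogonal projections
fixing `Ω`.  If (i) the closure of `{PQ a QP Ω + i PQ b QP Ω : a ∈ M_h, b ∈ N_h}` is the range
of `PQ`, and (ii) the range of `Q` is the closure of `MΩ`, then `M = N′`. -/
theorem vonNeumann_haag_duality_sufficient_condition
    {H : Type*} [NormedAddCommGroup H] [InnerProductSpace ℂ H] [CompleteSpace H]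
    (M N : VonNeumannAlgebra H)
    (hMN : ∀ a : H →L[ℂ] H, a ∈ M → a ∈ N.commutant)
    (hfactor : ∀ T : H →L[ℂ] H, (∀ a ∈ M, T * a = a * T) → (∀ b ∈ N, T * b = b * T) →
      ∃ c : ℂ, T = c • (1 : H →L[ℂ] H))
    (Ω : H) (hΩ : ‖Ω‖ = 1)
    (P Q : H →L[ℂ] H) (hPM : P ∈ M) (hQN : Q ∈ N)
    (hPidem : P ∘L P = P) (hPsa : IsSelfAdjoint P)
    (hQidem : Q ∘L Q = Q) (hQsa : IsSelfAdjoint Q)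
    (hPΩ : P Ω = Ω) (hQΩ : Q Ω = Ω)
    (hyp1 : closure {v : H | ∃ a ∈ M, ∃ b ∈ N, IsSelfAdjoint a ∧ IsSelfAdjoint b ∧
        v = (P ∘L Q ∘L a ∘L Q ∘L P) Ω + Complex.I • ((P ∘L Q ∘L b ∘L Q ∘L P) Ω)}
      = Set.range ⇑(P ∘L Q))
    (hyp2 : Set.range ⇑Q = closure {v : H | ∃ a ∈ M, v = a Ω}) :
    M = N.commutant := by
  have hNM : ∀ a ∈ M, ∀ b ∈ N, ∀ ξ, b (a ξ) = a (b ξ) := fun a ha b hb ξ =>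
    DFunLike.congr_fun (VonNeumannAlgebra.mem_commutant_iff.1 (hMN a ha) b hb) ξ
  have hP : ∀ ξ η, inner ℂ (P ξ) η = inner ℂ ξ (P η) := hPsa.isSymmetric
  have hQ : ∀ ξ η, inner ℂ (Q ξ) η = inner ℂ ξ (Q η) := hQsa.isSymmetric
  have hQP : ∀ ξ, Q (P ξ) = P (Q ξ) := hNM P hPM Q hQN
  have hreal : ∀ T ∈ M.commutant, IsSelfAdjoint T → ∀ c ∈ N.commutant, IsSelfAdjoint c →
      (inner ℂ (c Ω) (T Ω)).im = 0 := by
    intro T hT hTsa c hc hcsa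
    rw [VonNeumannAlgebra.mem_commutant_iff] at hT hc
    have hPT : P (T Ω) = T Ω := by
      simpa [hPΩ] using DFunLike.congr_fun (hT P hPM) Ω
    have hQc : Q (c Ω) = c Ω := by
      simpa [hQΩ] using DFunLike.congr_fun (hc Q hQN) Ω
    have hmem : Complex.I • Q (T Ω) ∈ Set.range ⇑(P ∘L Q) :=
      ⟨Complex.I • T Ω, by simp [← hQP, hPT]⟩
    rw [← hyp1] at hmem
    have key := inner_im_eq_zero_of_mem_closure (w := P (c Ω)) hmem ?_
    · rwa [hP, ← hQP, hPT, ← hQ, hQc] at key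
    · rintro x ⟨a, ha, b, hb, hasa, hbsa, rfl⟩
      have hQa : Q (a Ω) = a Ω := by rw [hNM a ha Q hQN, hQΩ]
      have hPb : P (b Ω) = b Ω := by rw [← hNM P hPM b hb, hPΩ]
      refine ⟨P (a Ω), Q (b Ω), by simp [hPΩ, hQΩ, hQa, ← hQP, hPb], ?_, ?_, ?_⟩
      · rw [hP, ← hQP, hPb, ← hQ, hQa]
        exact hasa.inner_im_eq_zero_of_commute hbsa
          (ContinuousLinearMap.ext fun ξ => (hNM a ha b hb ξ).symm) Ω
      · rw [hP, ← hQP, hPT, ← hQ, hQa]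
        exact hasa.inner_im_eq_zero_of_commute hTsa (hT a ha) Ω
      · rw [hP, ← hQP, hPb, ← hQ, hQc]
        exact hcsa.inner_im_eq_zero_of_commute hbsa (hc b hb).symm Ω
  let B : (H →L[ℂ] H) →ₗ[ℂ] (H →L[ℂ] H) →ₗ[ℂ] ℂ :=
    LinearMap.mk₂ ℂ (fun T c => inner ℂ Ω (T (c Ω)) - inner ℂ Ω (c (T Ω)))
      (by intros; simp; ring) (by intros; simp; ring)
      (by intros; simp; ring) (by intros; simp; ring)
  have hB : ∀ T ∈ M.commutant, ∀ c ∈ N.commutant, B T c = 0 := by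
    intro T hT c hc
    refine M.commutant.linearMap_eq_zero_of_selfAdjoint (B.flip c) (fun T hT hTsa => ?_) hT
    refine N.commutant.linearMap_eq_zero_of_selfAdjoint (B T) (fun c hc hcsa => ?_) hc
    have h := hreal T hT hTsa c hc hcsa
    have h1 : inner ℂ Ω (c (T Ω)) = inner ℂ (c Ω) (T Ω) := (hcsa.isSymmetric _ _).symm
    have h2 : inner ℂ Ω (T (c Ω)) = inner ℂ (T Ω) (c Ω) := (hTsa.isSymmetric _ _).symm
    change inner ℂ Ω (T (c Ω)) - inner ℂ Ω (c (T Ω)) = 0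
    rw [h1, h2, ← inner_conj_symm, Complex.conj_eq_iff_im.2 h, sub_self]
  let E : Submodule ℂ H := Submodule.span ℂ {v | ∃ b ∈ N, ∃ a ∈ M, v = b (a Ω)}
  let K : Submodule ℂ H := E.topologicalClosure
  have hKinv : ∀ y : H →L[ℂ] H, (∀ b ∈ N, ∀ a ∈ M, y (b (a Ω)) ∈ E) → ∀ x ∈ K, y x ∈ K := by
    intro y hy x hx
    have hE : ∀ x ∈ E, y x ∈ E := fun x hx => by
      refine Submodule.span_le (p := E.comap y.toLinearMap) |>.2 ?_ hx
      rintro _ ⟨b, hb, a, ha, rfl⟩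
      exact hy b hb a ha
    exact map_mem_closure y.continuous hx hE
  have hKM : ∀ y ∈ M, ∀ x ∈ K, y x ∈ K := fun y hyM => hKinv y fun b hb a ha =>
    Submodule.subset_span ⟨b, hb, y * a, mul_mem hyM ha, (hNM y hyM b hb _).symm⟩
  have hKN : ∀ y ∈ N, ∀ x ∈ K, y x ∈ K := fun y hyN => hKinv y fun b hb a ha =>
    Submodule.subset_span ⟨y * b, mul_mem hyN hb, a, ha, rfl⟩
  have : CompleteSpace K := E.isClosed_topologicalClosure.completeSpace_coe
  have hproj : ∀ V : VonNeumannAlgebra H, (∀ y ∈ V, ∀ x ∈ K, y x ∈ K) →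
      K.starProjection ∈ V.commutant := fun V hV => by
    rw [VonNeumannAlgebra.IsStarProjection.mem_iff isStarProjection_starProjection,
      VonNeumannAlgebra.commutant_commutant]
    intro y hy
    rw [Submodule.range_starProjection]
    exact hV y hy
  have hΩK : Ω ∈ K := E.le_topologicalClosure
    (Submodule.subset_span ⟨1, one_mem N, 1, one_mem M, rfl⟩)
  have hΩ0 : Ω ≠ 0 := fun h => by simp [h] at hΩ
  have hK : K = ⊤ := by
    obtain ⟨r, hr⟩ := hfactor K.starProjection
      (fun a ha => (VonNeumannAlgebra.mem_commutant_iff.1 (hproj M hKM) a ha).symm)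
      (fun b hb => (VonNeumannAlgebra.mem_commutant_iff.1 (hproj N hKN) b hb).symm)
    have h1 : r • Ω = Ω := by
      simpa [hr] using Submodule.starProjection_eq_self_iff.2 hΩK
    have hr1 : r = 1 := smul_left_injective ℂ hΩ0 (by simpa using h1)
    refine (Submodule.eq_top_iff').2 fun x => ?_
    rw [← Submodule.starProjection_eq_self_iff, hr, hr1]
    simp
  refine VonNeumannAlgebra.ext fun c => ⟨hMN c, fun hc => ?_⟩
  rw [← VonNeumannAlgebra.commutant_commutant M, VonNeumannAlgebra.mem_commutant_iff]
  intro T hT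
  have hdense : Dense (E : Set H) := Submodule.dense_iff_topologicalClosure_eq_top.2 hK
  have hNM' : ∀ b ∈ N, b ∈ M.commutant := fun b hb =>
    VonNeumannAlgebra.mem_commutant_iff.2 fun a ha =>
      ContinuousLinearMap.ext fun ξ => (hNM a ha b hb ξ).symm
  have hcN : ∀ b ∈ N, ∀ ξ, b (c ξ) = c (b ξ) := fun b hb ξ =>
    DFunLike.congr_fun (VonNeumannAlgebra.mem_commutant_iff.1 hc b hb) ξ
  have hTM : ∀ a ∈ M, ∀ ξ, a (T ξ) = T (a ξ) := fun a ha ξ =>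
    DFunLike.congr_fun (VonNeumannAlgebra.mem_commutant_iff.1 hT a ha) ξ
  have hgen : ∀ b₁ ∈ N, ∀ a₁ ∈ M, ∀ b₂ ∈ N, ∀ a₂ ∈ M,
      inner ℂ (b₁ (a₁ Ω)) ((T * c - c * T) (b₂ (a₂ Ω))) = 0 := by
    intro b₁ hb₁ a₁ ha₁ b₂ hb₂ a₂ ha₂
    have h := hB (star b₁ * T * b₂)
      (mul_mem (mul_mem (star_mem (hNM' b₁ hb₁)) hT) (hNM' b₂ hb₂))
      (star a₁ * c * a₂) (mul_mem (mul_mem (star_mem (hMN a₁ ha₁)) hc) (hMN a₂ ha₂))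
    change inner ℂ Ω (star b₁ (T (b₂ (star a₁ (c (a₂ Ω)))))) -
      inner ℂ Ω (star a₁ (c (a₂ (star b₁ (T (b₂ Ω)))))) = 0 at h
    have hsa := star_mem ha₁
    have hsb := star_mem hb₁
    rw [hNM _ hsa _ hb₂, ← hTM _ hsa, hNM _ hsa _ hsb, hcN _ hb₂,
      ← hNM _ ha₂ _ hsb, ← hcN _ hsb, hTM _ ha₂, ← hNM _ ha₂ _ hb₂, ← inner_sub_right,
      ← map_sub, ← map_sub, ContinuousLinearMap.star_eq_adjoint,
      ContinuousLinearMap.star_eq_adjoint, ContinuousLinearMap.adjoint_inner_right,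
      ContinuousLinearMap.adjoint_inner_right] at h
    exact h
  have hcomm : T * c - c * T = 0 := by
    refine ContinuousLinearMap.ext_on hdense ?_
    rintro _ ⟨b₂, hb₂, a₂, ha₂, rfl⟩
    refine hdense.eq_zero_of_inner_right ℂ fun v hv => ?_
    induction hv using Submodule.span_induction with
    | mem v hv =>
      obtain ⟨b₁, hb₁, a₁, ha₁, rfl⟩ := hv
      exact hgen b₁ hb₁ a₁ ha₁ b₂ hb₂ a₂ ha₂
    | zero => exact inner_zero_left _
    | add v w _ _ hv hw => rw [inner_add_left, hv, hw, add_zero]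
    | smul r v _ hv => rw [inner_smul_left, hv, mul_zero]
  exact sub_eq_zero.1 hcomm
end

section
/- Let H be a complex Hilbert space, and let M and N be von Neumann algebras on H with M ⊆ N′. Let Ω ∈ H be a unit vector, and let P ∈ M and Q ∈ N be orthogonal projections with PΩ = Ω = QΩ. Assume: (i) the closure of the set { PQ a QP Ω + i PQ b QP Ω : a ∈ M_h, b ∈ N_h } equals the range of the projection PQ; and (ii) the range of Q equals the closure of MΩ. Then the closure of the set { a Ω + i Q b Q Ω : a ∈ M_h, b ∈ N_h } equals the range of Q. -/
/-- **Step 1 of the sufficient condition for Haag duality.**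
Under the same hypotheses as the sufficient condition (but without the factor assumption),
the closure of `{a Ω + i Q b Q Ω : a ∈ M_h, b ∈ N_h}` equals the range of `Q`. -/
theorem vonNeumann_haag_duality_step_one
    {H : Type*} [NormedAddCommGroup H] [InnerProductSpace ℂ H] [CompleteSpace H]
    (M N : VonNeumannAlgebra H)
    (hMN : ∀ a : H →L[ℂ] H, a ∈ M → a ∈ N.commutant)
    (Ω : H) (hΩ : ‖Ω‖ = 1)
    (P Q : H →L[ℂ] H) (hPM : P ∈ M) (hQN : Q ∈ N)
    (hPidem : P ∘L P = P) (hPsa : IsSelfAdjoint P)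
    (hQidem : Q ∘L Q = Q) (hQsa : IsSelfAdjoint Q)
    (hPΩ : P Ω = Ω) (hQΩ : Q Ω = Ω)
    (hyp1 : closure {v : H | ∃ a ∈ M, ∃ b ∈ N, IsSelfAdjoint a ∧ IsSelfAdjoint b ∧
        v = (P ∘L Q ∘L a ∘L Q ∘L P) Ω + Complex.I • ((P ∘L Q ∘L b ∘L Q ∘L P) Ω)}
      = Set.range ⇑(P ∘L Q))
    (hyp2 : Set.range ⇑Q = closure {v : H | ∃ a ∈ M, v = a Ω}) :
    closure {v : H | ∃ a ∈ M, ∃ b ∈ N, IsSelfAdjoint a ∧ IsSelfAdjoint b ∧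
        v = a Ω + Complex.I • ((Q ∘L b ∘L Q) Ω)}
      = Set.range ⇑Q := by
  have comm : ∀ a ∈ M, ∀ b ∈ N, ∀ v, b (a v) = a (b v) := fun a ha b hb v =>
    DFunLike.congr_fun (VonNeumannAlgebra.mem_commutant_iff.1 (hMN a ha) b hb) v
  have hrange : IsClosed (Set.range ⇑Q) := hyp2 ▸ isClosed_closure
  apply subset_antisymm
  · refine closure_minimal ?_ hrange
    rintro _ ⟨a, ha, b, -, -, -, rfl⟩
    exact ⟨a Ω + Complex.I • b Ω, by simp [comm a ha Q hQN, hQΩ]⟩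
  rw [hyp2]
  refine closure_minimal ?_ isClosed_closure
  rintro _ ⟨x, hx, rfl⟩
  -- `x Ω` is the sum of `P x Ω`, which `hyp1` controls, and `(1 - P) x Ω = c Ω`.
  let c : H →L[ℂ] H := (1 - P) * x * P + star ((1 - P) * x * P)
  have hcM : c ∈ M := by
    have h : (1 - P) * x * P ∈ M := mul_mem (mul_mem (sub_mem (one_mem M) hPM) hx) hPM
    exact add_mem h (star_mem h)
  have hcsa : IsSelfAdjoint c := IsSelfAdjoint.add_star_self _
  have hcΩ : c Ω = x Ω - P (x Ω) := by
    simp [c, star_mul, hPsa.star_eq, hPΩ]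
  have hPx : P (x Ω) ∈ Set.range ⇑(P ∘L Q) :=
    ⟨x Ω, by simp [comm x hx Q hQN, hQΩ]⟩
  rw [← hyp1] at hPx
  have key := map_mem_closure (f := fun v => v + c Ω) (by fun_prop) hPx
    (t := {v : H | ∃ a ∈ M, ∃ b ∈ N, IsSelfAdjoint a ∧ IsSelfAdjoint b ∧
        v = a Ω + Complex.I • ((Q ∘L b ∘L Q) Ω)}) ?_
  · simpa [hcΩ] using key
  rintro _ ⟨a, ha, b, hb, hasa, hbsa, rfl⟩
  refine ⟨P * a * P + c, add_mem (mul_mem (mul_mem hPM ha) hPM) hcM, b, hb, ?_, hbsa, ?_⟩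
  · refine IsSelfAdjoint.add ?_ hcsa
    simp [isSelfAdjoint_iff, star_mul, hPsa.star_eq, hasa.star_eq, mul_assoc]
  · have h1 : P (Q (b Ω)) = Q (b Ω) := by
      rw [← comm P hPM Q hQN, ← comm P hPM b hb, hPΩ]
    simp only [ContinuousLinearMap.comp_apply, add_apply,
      mul_apply_eq_comp, hPΩ, hQΩ, h1, comm a ha Q hQN]
    abel
end

section
/- Let H be a complex Hilbert space, let F be a von Neumann algebra on H that is finite-dimensional as a ℂ-vector space and is a factor (F ∩ F′ = ℂ·1), and let C be a von Neumann algebra on H with C ⊆ F′. Let R := (F ∪ C)′ be the commutant of the union. Then the von Neumann algebra generated by F ∪ R equals C′, i.e. (F ∪ R)″ = C′. -/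
/-- An Artinian ring which is a C⋆-ring is semisimple. -/
theorem CStarRing.isSemisimpleRing (A : Type*) [NormedRing A] [StarRing A] [CStarRing A]
    [IsArtinianRing A] : IsSemisimpleRing A := by
  rw [IsArtinianRing.isSemisimpleRing_iff_jacobson, eq_bot_iff]
  intro x hx
  obtain ⟨n, hn⟩ := IsArtinianRing.isNilpotent_jacobson_bot (R := A)
  have hy : star x * x ∈ Ideal.jacobson (⊥ : Ideal A) := by
    rw [Ideal.jacobson_bot]
    exact Ideal.mul_mem_left _ _ hx
  have hpow : (star x * x) ^ 2 ^ n = 0 := by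
    refine pow_eq_zero_of_le (m := n) n.lt_two_pow_self.le ?_
    simpa [hn] using Ideal.pow_mem_pow hy n
  have hnorm := (IsSelfAdjoint.star_mul_self x).norm_pow_two_pow n
  rw [hpow, norm_zero, eq_comm] at hnorm
  have := norm_eq_zero.mp (eq_zero_of_pow_eq_zero hnorm)
  simpa using (CStarRing.star_mul_self_eq_zero_iff x).mp this

/-- A finite-dimensional central semisimple algebra over an algebraically closed field is
a matrix algebra. -/
theorem IsSemisimpleRing.exists_algEquiv_matrix_of_isCentral (K A : Type*) [Field K]
    [IsAlgClosed K] [Ring A] [Nontrivial A] [Algebra K A] [FiniteDimensional K A]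
    [IsSemisimpleRing A] [Algebra.IsCentral K A] :
    ∃ n : ℕ, Nonempty (A ≃ₐ[K] Matrix (Fin n) (Fin n) K) := by
  obtain ⟨n, d, hd, ⟨e⟩⟩ := IsSemisimpleRing.exists_algEquiv_pi_matrix_of_isAlgClosed K A
  have : Nontrivial (Π i, Matrix (Fin (d i)) (Fin (d i)) K) := e.symm.toEquiv.nontrivial
  have hcen (a : Fin n) : ∃ c : K, algebraMap K _ c =
      (Pi.single a 1 : Π i, Matrix (Fin (d i)) (Fin (d i)) K) := by
    have hmem : e.symm (Pi.single a 1) ∈ Subalgebra.center K A := by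
      rw [Subalgebra.mem_center_iff]
      intro b
      apply e.injective
      ext i : 1
      rcases eq_or_ne i a with rfl | h <;> simp [*]
    obtain ⟨c, hc⟩ := Algebra.mem_bot.mp (Algebra.IsCentral.out hmem)
    exact ⟨c, by rw [← e.commutes, hc, e.apply_symm_apply]⟩
  have hsub (a b : Fin n) : a = b := by
    by_contra hab
    obtain ⟨c, hc⟩ := hcen a
    have ha := congr_fun hc a
    have hb := congr_fun hc b
    rw [Pi.single_eq_same, Pi.algebraMap_apply] at ha
    rw [Pi.single_eq_of_ne (Ne.symm hab), Pi.algebraMap_apply, map_eq_zero] at hb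
    simp [hb] at ha
  obtain rfl | hn := n.eq_zero_or_pos
  · exact (not_subsingleton (Π i, Matrix (Fin (d i)) (Fin (d i)) K) inferInstance).elim
  · let _ : Unique (Fin n) := ⟨⟨⟨0, hn⟩⟩, fun _ ↦ hsub _ _⟩
    exact ⟨d default, ⟨e.trans (.ofRingEquiv (f := .piUnique _) fun _ ↦ rfl)⟩⟩

section MatrixCoefficient

open Matrix

variable {K A n : Type*} [CommRing K] [Ring A] [Algebra K A] [Fintype n] [DecidableEq n]

/-- The `(i, j)` coefficient of `T` with respect to the matrix units in the image of `φ`. -/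
def Matrix.coefficient (φ : Matrix n n K →ₐ[K] A) (T : A) (i j : n) : A :=
  ∑ k, φ (single k i 1) * T * φ (single j k 1)

theorem Matrix.sum_coefficient_mul (φ : Matrix n n K →ₐ[K] A) (T : A) :
    ∑ i, ∑ j, coefficient φ T i j * φ (single i j 1) = T := by
  have hsum : ∑ i, φ (single i i 1) = 1 := by
    rw [← map_sum, sum_single_one, map_one]
  calc ∑ i, ∑ j, coefficient φ T i j * φ (single i j 1)
      = ∑ i, ∑ j, φ (single i i 1) * T * φ (single j j 1) := by
        refine Finset.sum_congr rfl fun i _ ↦ Finset.sum_congr rfl fun j _ ↦ ?_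
        rw [coefficient, Finset.sum_mul, Finset.sum_eq_single i]
        · rw [mul_assoc, ← map_mul, single_mul_single_same, mul_one]
        · intro k _ hk
          rw [mul_assoc, ← map_mul, single_mul_single_of_ne (h := hk), map_zero, mul_zero]
        · simp
    _ = T := by
        simp_rw [← Finset.mul_sum, hsum, mul_one, ← Finset.sum_mul, hsum, one_mul]

theorem Matrix.commute_coefficient (φ : Matrix n n K →ₐ[K] A) (T : A) (i j : n)
    (m : Matrix n n K) : Commute (φ m) (coefficient φ T i j) := by
  have hunit (a b : n) : Commute (φ (single a b 1)) (coefficient φ T i j) := by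
    rw [commute_iff_eq, coefficient, Finset.mul_sum, Finset.sum_mul, Finset.sum_eq_single b,
      Finset.sum_eq_single a]
    · rw [← mul_assoc, ← mul_assoc, ← map_mul, mul_assoc _ _ (φ (single a b 1)), ← map_mul,
        single_mul_single_same, single_mul_single_same, mul_one]
    · intro k _ hk
      rw [mul_assoc, ← map_mul, single_mul_single_of_ne (h := hk), map_zero, mul_zero]
    · simp
    · intro k _ hk
      rw [← mul_assoc, ← mul_assoc, ← map_mul, single_mul_single_of_ne (h := hk.symm), map_zero,
        zero_mul, zero_mul]
    · simp
  rw [matrix_eq_sum_single m, map_sum]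
  refine Commute.sum_left _ _ _ fun a _ ↦ ?_
  rw [map_sum]
  refine Commute.sum_left _ _ _ fun b _ ↦ ?_
  have : single a b (m a b) = m a b • single a b (1 : K) := by simp
  rw [this, map_smul]
  exact (hunit a b).smul_left _

end MatrixCoefficient

/-- **Stability of duality under removing a finite-dimensional factor.**
Let `F` be a finite-dimensional von Neumann algebra on `H` that is a factor,
and `C` a von Neumann algebra with `C ⊆ F′`.  If `R := (F ∪ C)′`, then `(F ∪ R)″ = C′`. -/
theorem vonNeumann_duality_remove_finite_factor
    {H : Type*} [NormedAddCommGroup H] [InnerProductSpace ℂ H] [CompleteSpace H]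
    (F C : VonNeumannAlgebra H)
    (hFfin : FiniteDimensional ℂ F.toStarSubalgebra)
    (hFfactor : ∀ T : H →L[ℂ] H, T ∈ F →
      T ∈ Set.centralizer (F : Set (H →L[ℂ] H)) → ∃ c : ℂ, T = c • (1 : H →L[ℂ] H))
    (hCF : (C : Set (H →L[ℂ] H)) ⊆ Set.centralizer (F : Set (H →L[ℂ] H)))
    (R : Set (H →L[ℂ] H))
    (hR : R = Set.centralizer ((F : Set (H →L[ℂ] H)) ∪ (C : Set (H →L[ℂ] H)))) :
    Set.centralizer (Set.centralizer ((F : Set (H →L[ℂ] H)) ∪ R))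
      = Set.centralizer (C : Set (H →L[ℂ] H)) := by
  have hFC : (F : Set (H →L[ℂ] H)) ⊆ Set.centralizer (C : Set (H →L[ℂ] H)) :=
    fun x hx c hc ↦ (hCF hc x hx).symm
  subst hR
  apply Set.Subset.antisymm
  · rw [← Set.centralizer_centralizer_centralizer (C : Set (H →L[ℂ] H))]
    exact Set.centralizer_subset <| Set.centralizer_subset <| Set.union_subset hFC <|
      Set.centralizer_subset Set.subset_union_right
  · rcases subsingleton_or_nontrivial H with hH | hH
    · intro T _ S _
      exact Subsingleton.elim _ _
    have : IsArtinianRing F.toStarSubalgebra := IsArtinianRing.of_finite ℂ _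
    have : IsSemisimpleRing F.toStarSubalgebra := CStarRing.isSemisimpleRing _
    have : Algebra.IsCentral ℂ F.toStarSubalgebra := by
      refine ⟨fun x hx ↦ ?_⟩
      obtain ⟨c, hc⟩ := hFfactor x x.2 fun y hy ↦
        congrArg Subtype.val (Subalgebra.mem_center_iff.mp hx ⟨y, hy⟩)
      exact Algebra.mem_bot.mpr ⟨c, Subtype.ext <| by rw [hc]; rfl⟩
    obtain ⟨n, ⟨e⟩⟩ :=
      IsSemisimpleRing.exists_algEquiv_matrix_of_isCentral ℂ F.toStarSubalgebra
    let φ : Matrix (Fin n) (Fin n) ℂ →ₐ[ℂ] (H →L[ℂ] H) :=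
      F.toStarSubalgebra.toSubalgebra.val.comp e.symm.toAlgHom
    have hφ (m) : φ m ∈ F := (e.symm m).2
    intro T hT
    have hR (i j) : Matrix.coefficient φ T i j ∈
        Set.centralizer ((F : Set (H →L[ℂ] H)) ∪ (C : Set (H →L[ℂ] H))) := by
      rintro x (hx | hx)
      · have := Matrix.commute_coefficient φ T i j (e ⟨x, hx⟩)
        rwa [show φ (e ⟨x, hx⟩) = x from congrArg Subtype.val (e.symm_apply_apply ⟨x, hx⟩)] at this
      · refine Commute.sum_right _ _ _ fun k _ ↦ ?_
        exact (Commute.mul_right (hFC (hφ _) x hx) (hT x hx)).mul_right (hFC (hφ _) x hx)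
    intro S hS
    rw [← Matrix.sum_coefficient_mul φ T]
    refine Commute.sum_right _ _ _ fun i _ ↦ Commute.sum_right _ _ _ fun j _ ↦ ?_
    exact Commute.mul_right (hS _ (Or.inr (hR i j))).symm (hS _ (Or.inl (hφ _))).symm
end

section
/- Let A be a C*-weak Hopf algebra with antipode S. There exists a linear map J : A → A such that: (1) J is a *-algebra antihomomorphism, i.e. J(xy) = J(y)J(x), J(x*) = J(x)*, and J(1) = 1 for all x, y ∈ A; (2) J is anticomultiplicative, i.e. J(x)_{(1)} ⊗ J(x)_{(2)} = J(x_{(2)}) ⊗ J(x_{(1)}) for all x ∈ A; (3) J is involutive, i.e. J ∘ J = id. Moreover, J can be chosen so that if S ∘ S = id then J = S. -/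
open scoped TensorProduct

noncomputable section

/-- An element of a `C*`-algebra is positive iff it is of the form `star y * y`. -/
def IsPosElem {A : Type*} [Mul A] [Star A] (x : A) : Prop := ∃ y : A, x = star y * y

section Helpers

variable {A : Type*} [NormedRing A] [StarRing A] [CStarRing A]
  [NormedAlgebra ℂ A] [StarModule ℂ A]

/-- Apply a linear functional to the first leg of a tensor (`⟨φ, u₁⟩ u₂`). -/
def lapp (φ : A →ₗ[ℂ] ℂ) : A ⊗[ℂ] A →ₗ[ℂ] A :=
  (TensorProduct.lid ℂ A).toLinearMap ∘ₗ TensorProduct.map φ LinearMap.id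

/-- Apply a linear functional to the second leg of a tensor (`⟨φ, u₂⟩ u₁`). -/
def rapp (φ : A →ₗ[ℂ] ℂ) : A ⊗[ℂ] A →ₗ[ℂ] A :=
  (TensorProduct.rid ℂ A).toLinearMap ∘ₗ TensorProduct.map LinearMap.id φ

/-- Apply a pair of linear functionals to the two legs of a tensor (`⟨φ, u₁⟩⟨ψ, u₂⟩`). -/
def papp (φ ψ : A →ₗ[ℂ] ℂ) : A ⊗[ℂ] A →ₗ[ℂ] ℂ :=
  (TensorProduct.lid ℂ ℂ).toLinearMap ∘ₗ TensorProduct.map φ ψ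

end Helpers

/-- A `C*`-weak Hopf algebra: a finite-dimensional unital `C*`-algebra `A` equipped with a
comultiplication `Δ` (written in Sweedler notation `Δ x = x₍₁₎ ⊗ x₍₂₎`), counit `ε` and
antipode `S`, satisfying the axioms of Böhm–Szlachányi.  The field `starT` is the
(componentwise) star operation on `A ⊗[ℂ] A`, characterized by additivity and its values on
pure tensors. -/
structure WeakHopfData (A : Type*) [NormedRing A] [StarRing A] [CStarRing A]
    [NormedAlgebra ℂ A] [StarModule ℂ A] [FiniteDimensional ℂ A] : Type _ where
  Δ : A →ₗ[ℂ] A ⊗[ℂ] A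
  ε : A →ₗ[ℂ] ℂ
  S : A ≃ₗ[ℂ] A
  starT : A ⊗[ℂ] A → A ⊗[ℂ] A
  starT_add : ∀ u v : A ⊗[ℂ] A, starT (u + v) = starT u + starT v
  starT_tmul : ∀ a b : A, starT (a ⊗ₜ[ℂ] b) = star a ⊗ₜ[ℂ] star b
  /-- coassociativity of the comultiplication -/
  coassoc : (TensorProduct.assoc ℂ A A A).toLinearMap ∘ₗ
      (TensorProduct.map Δ LinearMap.id) ∘ₗ Δ = (TensorProduct.map LinearMap.id Δ) ∘ₗ Δ
  /-- counit axiom, left version -/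
  counit_left : (TensorProduct.lid ℂ A).toLinearMap ∘ₗ (TensorProduct.map ε LinearMap.id) ∘ₗ Δ
      = LinearMap.id
  /-- counit axiom, right version -/
  counit_right : (TensorProduct.rid ℂ A).toLinearMap ∘ₗ (TensorProduct.map LinearMap.id ε) ∘ₗ Δ
      = LinearMap.id
  /-- the comultiplication is multiplicative -/
  Δ_mul : ∀ x y : A, Δ (x * y) = Δ x * Δ y
  /-- the star operation is comultiplicative -/
  Δ_star : ∀ x : A, Δ (star x) = starT (Δ x)
  /-- the unit is weakly comultiplicative:
  `(Δ ⊗ id)(Δ 1) = (Δ 1 ⊗ 1)(1 ⊗ Δ 1)` -/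
  Δ_one_weak : (TensorProduct.map Δ LinearMap.id) (Δ 1)
      = (Δ 1 ⊗ₜ[ℂ] (1 : A)) * ((TensorProduct.assoc ℂ A A A).symm ((1 : A) ⊗ₜ[ℂ] Δ 1))
  /-- the unit is weakly comultiplicative:
  `(Δ ⊗ id)(Δ 1) = (1 ⊗ Δ 1)(Δ 1 ⊗ 1)` -/
  Δ_one_weak' : (TensorProduct.map Δ LinearMap.id) (Δ 1)
      = ((TensorProduct.assoc ℂ A A A).symm ((1 : A) ⊗ₜ[ℂ] Δ 1)) * (Δ 1 ⊗ₜ[ℂ] (1 : A))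
  /-- the counit is weakly multiplicative: `ε (x y z) = ε (x y₍₁₎) ε (y₍₂₎ z)` -/
  ε_weak : ∀ x y z : A,
      ε (x * y * z) = papp (ε ∘ₗ LinearMap.mulLeft ℂ x) (ε ∘ₗ LinearMap.mulRight ℂ z) (Δ y)
  /-- the counit is weakly multiplicative: `ε (x y z) = ε (x y₍₂₎) ε (y₍₁₎ z)` -/
  ε_weak' : ∀ x y z : A,
      ε (x * y * z) = papp (ε ∘ₗ LinearMap.mulRight ℂ z) (ε ∘ₗ LinearMap.mulLeft ℂ x) (Δ y)
  /-- antipode axiom: `x₍₁₎ S(x₍₂₎) = ε (1₍₁₎ x) 1₍₂₎` -/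
  antipode_left : ∀ x : A,
      LinearMap.mul' ℂ A ((TensorProduct.map LinearMap.id S.toLinearMap) (Δ x))
        = lapp (ε ∘ₗ LinearMap.mulRight ℂ x) (Δ 1)
  /-- antipode axiom: `S(x₍₁₎) x₍₂₎ = 1₍₁₎ ε (x 1₍₂₎)` -/
  antipode_right : ∀ x : A,
      LinearMap.mul' ℂ A ((TensorProduct.map S.toLinearMap LinearMap.id) (Δ x))
        = rapp (ε ∘ₗ LinearMap.mulLeft ℂ x) (Δ 1)
  /-- the antipode is antimultiplicative -/
  S_antimul : ∀ x y : A, S (x * y) = S y * S x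
  /-- the antipode is anticomultiplicative -/
  S_anticomul : ∀ x : A,
      Δ (S x) = (TensorProduct.comm ℂ A A) ((TensorProduct.map S.toLinearMap S.toLinearMap) (Δ x))

namespace WeakHopfData

variable {A : Type*} [NormedRing A] [StarRing A] [CStarRing A]
  [NormedAlgebra ℂ A] [StarModule ℂ A] [FiniteDimensional ℂ A]

/-- The source counital map `ε^L (x) = x₍₁₎ S(x₍₂₎)`. -/
def εL (W : WeakHopfData A) : A →ₗ[ℂ] A :=
  LinearMap.mul' ℂ A ∘ₗ TensorProduct.map LinearMap.id W.S.toLinearMap ∘ₗ W.Δ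

/-- The target counital map `ε^R (x) = S(x₍₁₎) x₍₂₎`. -/
def εR (W : WeakHopfData A) : A →ₗ[ℂ] A :=
  LinearMap.mul' ℂ A ∘ₗ TensorProduct.map W.S.toLinearMap LinearMap.id ∘ₗ W.Δ

/-- Full contraction of the iterated coproduct `Δ⁽ⁿ⁾ x = x₍₁₎ ⊗ ⋯ ⊗ x₍ₙ₊₁₎` against a family
of `n+1` linear functionals: `sweedlerEval W n φ x = ⟨φ 0, x₍₁₎⟩ ⋯ ⟨φ n, x₍ₙ₊₁₎⟩`.
Since linear functionals separate the points of a tensor power, identities between iterated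
coproducts are faithfully expressed through these contractions. -/
def sweedlerEval (W : WeakHopfData A) : (n : ℕ) → (Fin (n + 1) → (A →ₗ[ℂ] ℂ)) → (A →ₗ[ℂ] ℂ)
  | 0, φ => φ 0
  | n + 1, φ => papp (sweedlerEval W n (Fin.init φ)) (φ (Fin.last (n + 1))) ∘ₗ W.Δ

end WeakHopfData

/-- A `C*`-weak Hopf algebra together with its canonical distinguished elements:
the Haar integral `h`, the dual Haar integral `hHat`, the square roots `gL`, `gR` of
`E^L h`, `E^R h` (whence the canonical grouplike element `g = gL * gR⁻¹`), real powers
`gLpow`, `gRpow` of `gL` and `gR`, and a positive square root operation `sqrt`;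
all characterized by the (uniquely determining) properties listed as fields. -/
structure HaarPkg (A : Type*) [NormedRing A] [StarRing A] [CStarRing A]
    [NormedAlgebra ℂ A] [StarModule ℂ A] [FiniteDimensional ℂ A] : Type _ where
  W : WeakHopfData A
  /-- the Haar integral -/
  h : A
  haar_left : ∀ x : A, x * h = WeakHopfData.εL W x * h
  haar_right : ∀ x : A, h * x = h * WeakHopfData.εR W x
  haar_counitL : WeakHopfData.εL W h = 1
  haar_counitR : WeakHopfData.εR W h = 1
  haar_idem : h * h = h
  haar_star : star h = h
  haar_S : W.S h = h
  haar_nondeg : ∀ y : A, ∃ φ ψ : A →ₗ[ℂ] ℂ, lapp φ (W.Δ h) = y ∧ rapp ψ (W.Δ h) = y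
  /-- the Haar integral of the dual weak Hopf algebra `A*`, as a linear functional on `A` -/
  hHat : A →ₗ[ℂ] ℂ
  hHat_pos : ∀ x : A, ∃ r : ℝ, 0 ≤ r ∧ hHat (star x * x) = (r : ℂ)
  hHat_S : ∀ x : A, hHat (W.S x) = hHat x
  /-- `gL = (E^L h)^{1/2}` -/
  gL : A
  /-- `gR = (E^R h)^{1/2}` -/
  gR : A
  gL_pos : IsPosElem gL
  gR_pos : IsPosElem gR
  gL_unit : IsUnit gL
  gR_unit : IsUnit gR
  gL_sq : gL * gL = rapp hHat (W.Δ h)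
  gR_sq : gR * gR = lapp hHat (W.Δ h)
  gL_mem : gL ∈ Set.range (WeakHopfData.εL W)
  gR_mem : gR ∈ Set.range (WeakHopfData.εR W)
  gR_S : gR = W.S gL
  gLR_comm : gL * gR = gR * gL
  /-- the canonical grouplike element `g = gL * gR⁻¹` is positive -/
  g_pos : IsPosElem (gL * Ring.inverse gR)
  g_unit : IsUnit (gL * Ring.inverse gR)
  /-- `Δ g = (g ⊗ g) Δ 1` -/
  g_grouplike : W.Δ (gL * Ring.inverse gR)
      = ((gL * Ring.inverse gR) ⊗ₜ[ℂ] (gL * Ring.inverse gR)) * W.Δ 1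
  /-- `Δ g = Δ 1 (g ⊗ g)` -/
  g_grouplike' : W.Δ (gL * Ring.inverse gR)
      = W.Δ 1 * ((gL * Ring.inverse gR) ⊗ₜ[ℂ] (gL * Ring.inverse gR))
  /-- `S g = g⁻¹` -/
  g_S : W.S (gL * Ring.inverse gR) = Ring.inverse (gL * Ring.inverse gR)
  /-- `S² x = g x g⁻¹` -/
  S_sq : ∀ x : A,
      W.S (W.S x) = (gL * Ring.inverse gR) * x * Ring.inverse (gL * Ring.inverse gR)
  /-- `h₍₁₎ ⊗ g h₍₂₎ g = h₍₂₎ ⊗ h₍₁₎` -/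
  haar_flip : TensorProduct.map LinearMap.id
      (LinearMap.mulLeft ℂ (gL * Ring.inverse gR) ∘ₗ LinearMap.mulRight ℂ (gL * Ring.inverse gR))
      (W.Δ h) = (TensorProduct.comm ℂ A A) (W.Δ h)
  /-- dual integral relation `⟨ĥ, x (h gL⁻²)⟩ = ε x` -/
  hHat_dual₁ : ∀ x : A, hHat (x * (h * (Ring.inverse gL * Ring.inverse gL))) = W.ε x
  /-- dual integral relation `⟨ĥ, (gR⁻² h) x⟩ = ε x` -/
  hHat_dual₂ : ∀ x : A, hHat ((Ring.inverse gR * Ring.inverse gR * h) * x) = W.ε x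
  /-- dual integral relation `⟨ĥ, (h gL⁻²)₍₂₎⟩ (h gL⁻²)₍₁₎ = 1` -/
  hHat_dual₃ : rapp hHat (W.Δ (h * (Ring.inverse gL * Ring.inverse gL))) = 1
  /-- dual integral relation `⟨ĥ, (gR⁻² h)₍₁₎⟩ (gR⁻² h)₍₂₎ = 1` -/
  hHat_dual₄ : lapp hHat (W.Δ (Ring.inverse gR * Ring.inverse gR * h)) = 1
  /-- the positive square root, via the continuous functional calculus -/
  sqrt : A → A
  sqrt_pos : ∀ x : A, IsPosElem x → IsPosElem (sqrt x)
  sqrt_mul_self : ∀ x : A, IsPosElem x → sqrt x * sqrt x = x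
  /-- real powers of `gL`, via the continuous functional calculus -/
  gLpow : ℝ → A
  /-- real powers of `gR`, via the continuous functional calculus -/
  gRpow : ℝ → A
  gLpow_one : gLpow 1 = gL
  gRpow_one : gRpow 1 = gR
  gLpow_zero : gLpow 0 = 1
  gRpow_zero : gRpow 0 = 1
  gLpow_add : ∀ s t : ℝ, gLpow (s + t) = gLpow s * gLpow t
  gRpow_add : ∀ s t : ℝ, gRpow (s + t) = gRpow s * gRpow t
  gLpow_pos : ∀ t : ℝ, IsPosElem (gLpow t)
  gRpow_pos : ∀ t : ℝ, IsPosElem (gRpow t)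
  gLpow_continuous : Continuous gLpow
  gRpow_continuous : Continuous gRpow

namespace HaarPkg

variable {A : Type*} [NormedRing A] [StarRing A] [CStarRing A]
  [NormedAlgebra ℂ A] [StarModule ℂ A] [FiniteDimensional ℂ A]
variable (P : HaarPkg A)

/-- The canonical grouplike element `g = gL gR⁻¹`. -/
def g : A := P.gL * Ring.inverse P.gR

/-- The Watatani index `ı = ε^L (h gL⁻²)` of the Haar conditional expectations. -/
def iotaEl : A := WeakHopfData.εL P.W (P.h * (Ring.inverse P.gL * Ring.inverse P.gL))

/-- The element `ȷ = ⟨ĥ, (gL⁻²)₍₁₎⟩ (gL⁻²)₍₂₎`, the dual analogue of the Watatani index. -/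
def jayEl : A := lapp P.hHat (P.W.Δ (Ring.inverse P.gL * Ring.inverse P.gL))

/-- The pulling-through element `Ω = ı⁻¹ gL⁻¹ h gL⁻¹`. -/
def Ω : A := Ring.inverse P.iotaEl * Ring.inverse P.gL * P.h * Ring.inverse P.gL

/-- The map `J x = g^{-1/2} S(x) g^{1/2}`, as a linear map. -/
def Jlin : A →ₗ[ℂ] A :=
  LinearMap.mulRight ℂ (P.sqrt P.g) ∘ₗ
    LinearMap.mulLeft ℂ (Ring.inverse (P.sqrt P.g)) ∘ₗ P.W.S.toLinearMap

/-- The functional `⟨ω, x⟩ = ⟨ĥ, ȷ⁻¹ gL⁻¹ gR⁻¹ x⟩` (the dual analogue of `Ω`). -/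
def ω : A →ₗ[ℂ] ℂ :=
  P.hHat ∘ₗ LinearMap.mulLeft ℂ (Ring.inverse P.jayEl * (Ring.inverse P.gL * Ring.inverse P.gR))

/-- `ξ_L = ı^{1/2} ȷ^{1/2} gL`. -/
def ξL : A := P.sqrt P.iotaEl * P.sqrt P.jayEl * P.gL

/-- `ξ_R = ı^{1/2} ȷ^{1/2} gR`. -/
def ξR : A := P.sqrt P.iotaEl * P.sqrt P.jayEl * P.gR

/-- `ξ = ξ_L ξ_R`. -/
def ξ : A := P.ξL * P.ξR

/-- `J^L x = gL⁻¹ S(x) gL`. -/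
def JL : A → A := fun x => Ring.inverse P.gL * P.W.S x * P.gL

/-- `J^R x = gL S⁻¹(x) gL⁻¹`. -/
def JR : A → A := fun x => P.gL * P.W.S.symm x * Ring.inverse P.gL

end HaarPkg

namespace WeakHopfData

open LinearMap TensorProduct

section Legs

variable {A : Type*} [NormedRing A] [NormedAlgebra ℂ A]

@[simp]
theorem lapp_tmul (φ : A →ₗ[ℂ] ℂ) (a b : A) : lapp φ (a ⊗ₜ[ℂ] b) = φ a • b := by
  simp [lapp]

@[simp]
theorem rapp_tmul (φ : A →ₗ[ℂ] ℂ) (a b : A) : rapp φ (a ⊗ₜ[ℂ] b) = φ b • a := by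
  simp [rapp]

@[simp]
theorem papp_tmul (φ ψ : A →ₗ[ℂ] ℂ) (a b : A) : papp φ ψ (a ⊗ₜ[ℂ] b) = φ a * ψ b := by
  simp [papp]

end Legs

variable {A : Type*} [NormedRing A] [StarRing A] [CStarRing A]
  [NormedAlgebra ℂ A] [StarModule ℂ A] [FiniteDimensional ℂ A]

variable (W : WeakHopfData A)

theorem S_one : W.S 1 = 1 := by
  have h := W.S_antimul 1 (W.S.symm 1)
  simpa using h.symm

theorem lapp_counit (x : A) : lapp W.ε (W.Δ x) = x :=
  LinearMap.congr_fun W.counit_left x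

theorem rapp_counit (x : A) : rapp W.ε (W.Δ x) = x :=
  LinearMap.congr_fun W.counit_right x

theorem Δ_mul_Δ_one (x : A) : W.Δ x * W.Δ 1 = W.Δ x := by
  rw [← W.Δ_mul, mul_one]

theorem Δ_one_mul_Δ (x : A) : W.Δ 1 * W.Δ x = W.Δ x := by
  rw [← W.Δ_mul, one_mul]

theorem starT_zero : W.starT 0 = 0 := by
  simpa using W.starT_tmul 0 0

theorem starT_Δ_one : W.starT (W.Δ 1) = W.Δ 1 := by
  rw [← W.Δ_star, star_one]

/-- The conjugate `x ↦ conj (ε (star x))` of the counit. -/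
def conjCounit : A →ₗ[ℂ] ℂ where
  toFun x := star (W.ε (star x))
  map_add' x y := by simp
  map_smul' c x := by simp

theorem counit_star (x : A) : W.ε (star x) = star (W.ε x) := by
  have h1 : ∀ u : A ⊗[ℂ] A, lapp W.conjCounit u = star (lapp W.ε (W.starT u)) := by
    intro u
    induction u with
    | zero => simp [W.starT_zero]
    | tmul a b => simp [W.starT_tmul, conjCounit]
    | add u v hu hv => simp [W.starT_add, hu, hv]
  have h2 : lapp W.conjCounit (W.Δ x) = x := by
    rw [h1, ← W.Δ_star, lapp_counit, star_star]
  have h3 : ∀ u : A ⊗[ℂ] A, W.conjCounit (rapp W.ε u) = W.ε (lapp W.conjCounit u) := by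
    intro u
    induction u with
    | zero => simp
    | tmul a b => simp [mul_comm]
    | add u v hu hv => simp [hu, hv]
  have h4 := h3 (W.Δ x)
  rw [h2, rapp_counit] at h4
  rw [← h4]
  simp [conjCounit]

/-- The convolution product of linear endomorphisms. -/
def conv (f g : A →ₗ[ℂ] A) : A →ₗ[ℂ] A :=
  LinearMap.mul' ℂ A ∘ₗ TensorProduct.map f g ∘ₗ W.Δ

theorem conv_assoc (f g k : A →ₗ[ℂ] A) : W.conv (W.conv f g) k = W.conv f (W.conv g k) := by
  ext x
  have hl : ∀ u : A ⊗[ℂ] A, LinearMap.mul' ℂ A (TensorProduct.map (W.conv f g) k u)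
      = LinearMap.mul' ℂ A (TensorProduct.map f (LinearMap.mul' ℂ A ∘ₗ TensorProduct.map g k)
          (TensorProduct.assoc ℂ A A A (TensorProduct.map W.Δ LinearMap.id u))) := by
    intro u
    induction u with
    | zero => simp
    | tmul a b =>
      simp only [map_tmul, conv, comp_apply, mul'_apply, id_apply]
      induction W.Δ a with
      | zero => simp
      | tmul c d => simp [mul_assoc]
      | add v w hv hw => simp [add_mul, add_tmul, hv, hw]
    | add u v hu hv => simp [hu, hv]
  have hr : ∀ u : A ⊗[ℂ] A, LinearMap.mul' ℂ A (TensorProduct.map f (W.conv g k) u)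
      = LinearMap.mul' ℂ A (TensorProduct.map f (LinearMap.mul' ℂ A ∘ₗ TensorProduct.map g k)
          (TensorProduct.map LinearMap.id W.Δ u)) := by
    intro u
    induction u with
    | zero => simp
    | tmul a b => simp [conv]
    | add u v hu hv => simp [hu, hv]
  have hc : TensorProduct.assoc ℂ A A A (TensorProduct.map W.Δ LinearMap.id (W.Δ x))
      = TensorProduct.map LinearMap.id W.Δ (W.Δ x) := LinearMap.congr_fun W.coassoc x
  change LinearMap.mul' ℂ A (TensorProduct.map (W.conv f g) k (W.Δ x))
    = LinearMap.mul' ℂ A (TensorProduct.map f (W.conv g k) (W.Δ x))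
  rw [hl, hr, hc]

theorem εL_apply (x : A) : W.εL x = lapp (W.ε ∘ₗ LinearMap.mulRight ℂ x) (W.Δ 1) :=
  W.antipode_left x

theorem εR_apply (x : A) : W.εR x = rapp (W.ε ∘ₗ LinearMap.mulLeft ℂ x) (W.Δ 1) :=
  W.antipode_right x

theorem εL_one : W.εL 1 = 1 := by
  rw [εL_apply, LinearMap.mulRight_one, LinearMap.comp_id, lapp_counit]

theorem εR_one : W.εR 1 = 1 := by
  rw [εR_apply, LinearMap.mulLeft_one, LinearMap.comp_id, rapp_counit]

theorem map_id_Δ_one : TensorProduct.map LinearMap.id W.Δ (W.Δ 1)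
    = TensorProduct.assoc ℂ A A A (TensorProduct.map W.Δ LinearMap.id (W.Δ 1)) :=
  (LinearMap.congr_fun W.coassoc 1).symm

/-- A right convolution inverse `S'` of the identity which is antimultiplicative absorbs `εR`. -/
theorem conv_εR {S' : A →ₗ[ℂ] A} (hmul : ∀ x y, S' (x * y) = S' y * S' x)
    (hS' : W.conv LinearMap.id S' = W.εL) : W.conv W.εR S' = S' := by
  ext x
  have h1 : ∀ p : A ⊗[ℂ] A, LinearMap.mul' ℂ A
      (TensorProduct.map LinearMap.id (S' ∘ₗ LinearMap.mulLeft ℂ x) p)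
      = LinearMap.mul' ℂ A (TensorProduct.map LinearMap.id S' p) * S' x := by
    intro p
    induction p with
    | zero => simp
    | tmul a b => simp [hmul, mul_assoc]
    | add u v hu hv => simp [hu, hv, add_mul]
  have h2 : ∀ p : A ⊗[ℂ] A, LinearMap.mul' ℂ A
      (TensorProduct.map LinearMap.id (S' ∘ₗ LinearMap.mulLeft ℂ x) p)
      = LinearMap.mul' ℂ A (TensorProduct.map LinearMap.id
          (S' ∘ₗ lapp W.ε ∘ₗ LinearMap.mulLeft ℂ (W.Δ x))
          (TensorProduct.map LinearMap.id W.Δ p)) := by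
    intro p
    induction p with
    | zero => simp
    | tmul a b => simp [← W.Δ_mul, lapp_counit]
    | add u v hu hv => simp only [map_add, hu, hv]
  have h3 : ∀ p q u : A ⊗[ℂ] A, LinearMap.mul' ℂ A (TensorProduct.map LinearMap.id
          (S' ∘ₗ lapp W.ε ∘ₗ LinearMap.mulLeft ℂ u) (TensorProduct.assoc ℂ A A A
            ((TensorProduct.assoc ℂ A A A).symm ((1 : A) ⊗ₜ[ℂ] q) * (p ⊗ₜ[ℂ] (1 : A)))))
      = LinearMap.mul' ℂ A (TensorProduct.map LinearMap.id
          (S' ∘ₗ lapp W.ε ∘ₗ LinearMap.mul ℂ _ (u * q))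
            (TensorProduct.map LinearMap.id ((TensorProduct.mk ℂ A A).flip 1) p)) := by
    intro p q u
    induction p with
    | zero => simp
    | add p p' hp hp' => simp only [add_tmul, mul_add, map_add, hp, hp']
    | tmul a b =>
      induction q with
      | zero => simp
      | add q q' hq hq' =>
        simp only [tmul_add, add_mul, mul_add, map_add, hq, hq', LinearMap.comp_add,
          TensorProduct.map_add_right, LinearMap.add_apply]
      | tmul c d => simp [mul_assoc]
  have h4 : ∀ u : A ⊗[ℂ] A, LinearMap.mul' ℂ A (TensorProduct.map LinearMap.id
          (S' ∘ₗ lapp W.ε ∘ₗ LinearMap.mul ℂ _ u)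
            (TensorProduct.map LinearMap.id ((TensorProduct.mk ℂ A A).flip 1) (W.Δ 1)))
      = LinearMap.mul' ℂ A (TensorProduct.map W.εR S' u) := by
    intro u
    induction u with
    | zero => simp
    | add u u' hu hu' =>
      simp only [map_add, LinearMap.comp_add, TensorProduct.map_add_right, LinearMap.add_apply,
        hu, hu']
    | tmul c d =>
      rw [map_tmul, LinearMap.mul'_apply, εR_apply]
      induction W.Δ 1 with
      | zero => simp
      | tmul a b => simp
      | add p p' hp hp' => simp only [map_add, add_mul, hp, hp']
  have h5 := LinearMap.congr_fun hS' 1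
  change LinearMap.mul' ℂ A (TensorProduct.map LinearMap.id S' (W.Δ 1)) = _ at h5
  change LinearMap.mul' ℂ A (TensorProduct.map W.εR S' (W.Δ x)) = _
  rw [← h4, ← W.Δ_mul_Δ_one x, ← h3, ← W.Δ_one_weak', ← W.map_id_Δ_one, ← h2, h1, h5, εL_one,
    one_mul]

theorem conv_εL : W.conv W.S.toLinearMap W.εL = W.S.toLinearMap := by
  ext x
  have h1 : ∀ p : A ⊗[ℂ] A, LinearMap.mul' ℂ A
      (TensorProduct.map (W.S.toLinearMap ∘ₗ LinearMap.mulRight ℂ x) LinearMap.id p)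
      = W.S x * LinearMap.mul' ℂ A (TensorProduct.map W.S.toLinearMap LinearMap.id p) := by
    intro p
    induction p with
    | zero => simp
    | tmul a b => simp [W.S_antimul, mul_assoc]
    | add u v hu hv => simp [hu, hv, mul_add]
  have h2 : ∀ p : A ⊗[ℂ] A, LinearMap.mul' ℂ A
      (TensorProduct.map (W.S.toLinearMap ∘ₗ LinearMap.mulRight ℂ x) LinearMap.id p)
      = LinearMap.mul' ℂ A (TensorProduct.map
          (W.S.toLinearMap ∘ₗ rapp W.ε ∘ₗ LinearMap.mulRight ℂ (W.Δ x)) LinearMap.id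
          (TensorProduct.map W.Δ LinearMap.id p)) := by
    intro p
    induction p with
    | zero => simp
    | tmul a b => simp [← W.Δ_mul, rapp_counit]
    | add u v hu hv => simp only [map_add, hu, hv]
  have h3 : ∀ p q u : A ⊗[ℂ] A, LinearMap.mul' ℂ A (TensorProduct.map
          (W.S.toLinearMap ∘ₗ rapp W.ε ∘ₗ LinearMap.mulRight ℂ u) LinearMap.id
            ((TensorProduct.assoc ℂ A A A).symm ((1 : A) ⊗ₜ[ℂ] q) * (p ⊗ₜ[ℂ] (1 : A))))
      = LinearMap.mul' ℂ A (TensorProduct.map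
          (W.S.toLinearMap ∘ₗ rapp W.ε ∘ₗ (LinearMap.mul ℂ _).flip (p * u)) LinearMap.id
            (TensorProduct.map (TensorProduct.mk ℂ A A 1) LinearMap.id q)) := by
    intro p q u
    induction q with
    | zero => simp
    | add p p' hp hp' => simp only [tmul_add, add_mul, map_add, hp, hp']
    | tmul a b =>
      induction p with
      | zero => simp
      | add q q' hq hq' =>
        simp only [add_tmul, add_mul, mul_add, map_add, hq, hq', LinearMap.comp_add,
          TensorProduct.map_add_left, LinearMap.add_apply]
      | tmul c d => simp [← mul_assoc]
  have h4 : ∀ u : A ⊗[ℂ] A, LinearMap.mul' ℂ A (TensorProduct.map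
          (W.S.toLinearMap ∘ₗ rapp W.ε ∘ₗ (LinearMap.mul ℂ _).flip u) LinearMap.id
            (TensorProduct.map (TensorProduct.mk ℂ A A 1) LinearMap.id (W.Δ 1)))
      = LinearMap.mul' ℂ A (TensorProduct.map W.S.toLinearMap W.εL u) := by
    intro u
    induction u with
    | zero => simp
    | add u u' hu hu' =>
      simp only [map_add, LinearMap.comp_add, TensorProduct.map_add_left, LinearMap.add_apply,
        hu, hu']
    | tmul c d =>
      rw [map_tmul, LinearMap.mul'_apply, εL_apply]
      induction W.Δ 1 with
      | zero => simp
      | tmul a b => simp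
      | add p p' hp hp' => simp only [map_add, mul_add, hp, hp']
  have h5 : LinearMap.mul' ℂ A (TensorProduct.map W.S.toLinearMap LinearMap.id (W.Δ 1)) = 1 :=
    W.εR_one
  change LinearMap.mul' ℂ A (TensorProduct.map W.S.toLinearMap W.εL (W.Δ x)) = _
  rw [← h4, ← W.Δ_one_mul_Δ x, ← h3, ← W.Δ_one_weak', ← h2, h1, h5, mul_one]
  rfl

/-- Uniqueness of the antipode. -/
theorem antipode_unique {S' : A →ₗ[ℂ] A} (hmul : ∀ x y, S' (x * y) = S' y * S' x)
    (hS' : W.conv LinearMap.id S' = W.εL) : S' = W.S.toLinearMap := by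
  have h : W.conv W.S.toLinearMap LinearMap.id = W.εR := rfl
  rw [← W.conv_εL, ← hS', ← conv_assoc, h, W.conv_εR hmul hS']

theorem counit_mul_εL (y z : A) : W.ε (y * W.εL z) = W.ε (y * z) := by
  have h : ∀ p : A ⊗[ℂ] A, W.ε (y * lapp (W.ε ∘ₗ LinearMap.mulRight ℂ z) p)
      = papp (W.ε ∘ₗ LinearMap.mulRight ℂ z) (W.ε ∘ₗ LinearMap.mulLeft ℂ y) p := by
    intro p
    induction p with
    | zero => simp
    | tmul a b => simp
    | add u v hu hv => simp [hu, hv, mul_add]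
  rw [εL_apply, h, ← W.ε_weak', mul_one]

theorem map_εL_Δ_one : TensorProduct.map W.εL LinearMap.id (W.Δ 1)
    = TensorProduct.map W.S.toLinearMap LinearMap.id (W.Δ 1) := by
  have h1 : ∀ p : A ⊗[ℂ] A, TensorProduct.map W.εL LinearMap.id p
      = TensorProduct.map (LinearMap.mul' ℂ A ∘ₗ TensorProduct.map LinearMap.id W.S.toLinearMap)
          LinearMap.id (TensorProduct.map W.Δ LinearMap.id p) := by
    intro p
    induction p with
    | zero => simp
    | tmul a b => simp [εL]
    | add u v hu hv => simp only [map_add, hu, hv]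
  have h2 : ∀ p q : A ⊗[ℂ] A,
      TensorProduct.map (LinearMap.mul' ℂ A ∘ₗ TensorProduct.map LinearMap.id W.S.toLinearMap)
          LinearMap.id
          ((TensorProduct.assoc ℂ A A A).symm ((1 : A) ⊗ₜ[ℂ] q) * (p ⊗ₜ[ℂ] (1 : A)))
      = (LinearMap.mul' ℂ A (TensorProduct.map LinearMap.id W.S.toLinearMap p) ⊗ₜ[ℂ] 1)
          * TensorProduct.map W.S.toLinearMap LinearMap.id q := by
    intro p q
    induction q with
    | zero => simp
    | add q q' hq hq' => simp only [tmul_add, add_mul, mul_add, map_add, hq, hq']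
    | tmul a b =>
      induction p with
      | zero => simp
      | add p p' hp hp' => simp only [add_tmul, add_mul, mul_add, map_add, hp, hp']
      | tmul c d => simp [W.S_antimul, mul_assoc]
  have h3 : LinearMap.mul' ℂ A (TensorProduct.map LinearMap.id W.S.toLinearMap (W.Δ 1)) = 1 :=
    W.εL_one
  rw [h1, W.Δ_one_weak', h2, h3, ← Algebra.TensorProduct.one_def, one_mul]

theorem εR_star (x : A) : W.εR (star x) = W.S (star (W.εL x)) := by
  have h1 : ∀ p : A ⊗[ℂ] A, star (lapp (W.ε ∘ₗ LinearMap.mulRight ℂ x) p)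
      = lapp (W.ε ∘ₗ LinearMap.mulLeft ℂ (star x)) (W.starT p) := by
    intro p
    induction p with
    | zero => simp [W.starT_zero]
    | tmul a b => simp [W.starT_tmul, ← W.counit_star]
    | add u v hu hv => simp [hu, hv, W.starT_add]
  have h2 : ∀ (φ : A →ₗ[ℂ] ℂ) (p : A ⊗[ℂ] A),
      rapp φ (TensorProduct.comm ℂ A A (TensorProduct.map W.S.toLinearMap W.S.toLinearMap p))
      = W.S (lapp φ (TensorProduct.map W.S.toLinearMap LinearMap.id p)) := by
    intro φ p
    induction p with
    | zero => simp
    | tmul a b => simp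
    | add u v hu hv => simp only [map_add, hu, hv]
  have h3 : ∀ p : A ⊗[ℂ] A, lapp (W.ε ∘ₗ LinearMap.mulLeft ℂ (star x))
      (TensorProduct.map W.εL LinearMap.id p)
      = lapp (W.ε ∘ₗ LinearMap.mulLeft ℂ (star x)) p := by
    intro p
    induction p with
    | zero => simp
    | tmul a b => simp [counit_mul_εL]
    | add u v hu hv => simp only [map_add, hu, hv]
  have h4 := W.S_anticomul 1
  rw [S_one] at h4
  rw [εL_apply, h1, starT_Δ_one, ← h3, map_εL_Δ_one, ← h2, ← h4, εR_apply]

/-- The map `x ↦ star (S⁻¹ (star x))`. -/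
def starSymmStar : A →ₗ[ℂ] A where
  toFun x := star (W.S.symm (star x))
  map_add' x y := by simp
  map_smul' c x := by simp

theorem S_symm_antimul (x y : A) : W.S.symm (x * y) = W.S.symm y * W.S.symm x := by
  apply W.S.injective
  simp [W.S_antimul]

theorem starSymmStar_eq : W.starSymmStar = W.S.toLinearMap := by
  apply W.antipode_unique
  · intro x y
    simp [starSymmStar, S_symm_antimul]
  · ext x
    have h : ∀ u : A ⊗[ℂ] A,
        LinearMap.mul' ℂ A (TensorProduct.map LinearMap.id W.starSymmStar u)
        = star (W.S.symm (LinearMap.mul' ℂ A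
            (TensorProduct.map W.S.toLinearMap LinearMap.id (W.starT u)))) := by
      intro u
      induction u with
      | zero => simp [W.starT_zero]
      | tmul a b => simp [W.starT_tmul, starSymmStar, S_symm_antimul]
      | add u v hu hv => simp [hu, hv, W.starT_add]
    change LinearMap.mul' ℂ A (TensorProduct.map LinearMap.id W.starSymmStar (W.Δ x)) = _
    rw [h, ← W.Δ_star]
    change star (W.S.symm (W.εR (star x))) = _
    rw [εR_star, LinearEquiv.symm_apply_apply, star_star]

theorem star_S (x : A) : star (W.S x) = W.S.symm (star x) := by
  have h := LinearMap.congr_fun W.starSymmStar_eq x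
  simp only [starSymmStar, LinearMap.coe_mk, AddHom.coe_mk, LinearEquiv.coe_coe] at h
  rw [← h, star_star]

end WeakHopfData

section RegularTrace

open ComplexOrder

variable {A : Type*} [Ring A] [Algebra ℂ A]

/-- The trace of left multiplication. -/
def regTrace : A →ₗ[ℂ] ℂ := LinearMap.trace ℂ A ∘ₗ (Algebra.lmul ℂ A).toLinearMap

theorem regTrace_mul_comm (a b : A) : regTrace (a * b) = regTrace (b * a) := by
  simp only [regTrace, LinearMap.comp_apply, AlgHom.toLinearMap_apply, map_mul]
  exact LinearMap.trace_mul_comm ℂ _ _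

theorem regTrace_algEquiv (e : A ≃ₐ[ℂ] A) (a : A) : regTrace (e a) = regTrace a := by
  simp only [regTrace, LinearMap.comp_apply, AlgHom.toLinearMap_apply]
  rw [← LinearMap.trace_conj' (Algebra.lmul ℂ A a) e.toLinearEquiv]
  congr 1
  ext b
  simp [LinearEquiv.conj_apply]

variable [FiniteDimensional ℂ A]

theorem mem_roots_charpoly_lmul (a : A) (μ : ℂ) :
    μ ∈ (LinearMap.charpoly (Algebra.lmul ℂ A a)).roots ↔ μ ∈ spectrum ℂ a := by
  rw [Polynomial.mem_roots (LinearMap.charpoly_monic _).ne_zero,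
    ← Module.End.hasEigenvalue_iff_isRoot_charpoly, Module.End.hasEigenvalue_iff_mem_spectrum]
  refine ⟨fun h => AlgHom.spectrum_apply_subset _ a h, fun h hu => h ?_⟩
  rw [spectrum.mem_resolventSet_iff] at hu ⊢
  have hu' : IsUnit (Algebra.lmul ℂ A (algebraMap ℂ A μ - a)) := by
    rwa [map_sub, AlgHom.commutes]
  obtain ⟨b, hb⟩ := ((Module.End.isUnit_iff _).1 hu').2 1
  rw [Algebra.coe_lmul_eq_mul, LinearMap.mul_apply'] at hb
  refine ⟨⟨_, b, hb, ?_⟩, rfl⟩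
  apply ((Module.End.isUnit_iff _).1 hu').1
  rw [Algebra.coe_lmul_eq_mul, LinearMap.mul_apply', LinearMap.mul_apply', ← mul_assoc, hb,
    one_mul, mul_one]

theorem regTrace_eq_sum (a : A) :
    regTrace a = (LinearMap.charpoly (Algebra.lmul ℂ A a)).roots.sum :=
  Module.End.trace_eq_sum_roots_charpoly_of_splits (IsAlgClosed.splits _)

theorem regTrace_nonneg {a : A} (h : ∀ μ ∈ spectrum ℂ a, 0 ≤ μ) : 0 ≤ regTrace a := by
  rw [regTrace_eq_sum]
  exact Multiset.sum_nonneg fun μ hμ => h μ ((mem_roots_charpoly_lmul a μ).1 hμ)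

theorem spectrum_subset_zero_of_regTrace_eq_zero {a : A} (h : ∀ μ ∈ spectrum ℂ a, 0 ≤ μ)
    (h0 : regTrace a = 0) : spectrum ℂ a ⊆ {0} := fun μ hμ =>
  Multiset.all_zero_of_le_zero_le_of_sum_eq_zero
    (fun ν hν => h ν ((mem_roots_charpoly_lmul a ν).1 hν)) ((regTrace_eq_sum a).symm.trans h0) μ
    ((mem_roots_charpoly_lmul a μ).2 hμ)

end RegularTrace

section Positivity

open ComplexOrder

variable {A : Type*} [NormedRing A] [StarRing A] [CStarRing A]
  [NormedAlgebra ℂ A] [StarModule ℂ A] [FiniteDimensional ℂ A]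

theorem spectrum_star_mul_self_nonneg_of_finiteDimensional (x : A) :
    ∀ μ ∈ spectrum ℂ (star x * x), 0 ≤ μ := by
  let _ : CStarAlgebra A := { complete := (FiniteDimensional.complete ℂ A).complete }
  intro μ hμ
  rw [← (IsSelfAdjoint.star_mul_self x).spectrumRestricts.algebraMap_image] at hμ
  obtain ⟨r, hr, rfl⟩ := hμ
  simpa using spectrum_star_mul_self_nonneg r hr

theorem eq_zero_of_regTrace_star_mul_self {x : A} (h : regTrace (star x * x) = 0) : x = 0 := by
  let _ : CStarAlgebra A := { complete := (FiniteDimensional.complete ℂ A).complete }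
  have h1 := spectrum_subset_zero_of_regTrace_eq_zero
    (spectrum_star_mul_self_nonneg_of_finiteDimensional x) h
  have h2 : star x * x = 0 :=
    CFC.eq_zero_of_spectrum_subset_zero _ h1 (IsSelfAdjoint.star_mul_self x).isStarNormal
  exact CStarRing.star_mul_self_eq_zero_iff x |>.1 h2

end Positivity

namespace WeakHopfData

open ComplexOrder

variable {A : Type*} [NormedRing A] [StarRing A] [CStarRing A]
  [NormedAlgebra ℂ A] [StarModule ℂ A] [FiniteDimensional ℂ A] (W : WeakHopfData A)

/-- The square of the antipode. -/
def Ssq : Module.End ℂ A := W.S.toLinearMap ∘ₗ W.S.toLinearMap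

@[simp]
theorem Ssq_apply (x : A) : W.Ssq x = W.S (W.S x) := rfl

/-- The square of the antipode as an algebra automorphism. -/
def SsqEquiv : A ≃ₐ[ℂ] A :=
  AlgEquiv.ofLinearEquiv (W.S.trans W.S) (by simp [S_one]) (by simp [W.S_antimul])

theorem spectrum_S_subset (a : A) : spectrum ℂ (W.S a) ⊆ spectrum ℂ a := by
  intro μ hμ hu
  apply hμ
  rw [spectrum.mem_resolventSet_iff] at hu ⊢
  obtain ⟨⟨u, v, huv, hvu⟩, rfl : u = _⟩ := hu
  refine ⟨⟨W.S (algebraMap ℂ A μ - a), W.S v, ?_, ?_⟩, ?_⟩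
  · rw [← W.S_antimul, hvu, S_one]
  · rw [← W.S_antimul, huv, S_one]
  · simp [Algebra.algebraMap_eq_smul_one, S_one]

/-- An antipode-invariant faithful positive trace. -/
def invTrace : A →ₗ[ℂ] ℂ := regTrace + regTrace ∘ₗ W.S.toLinearMap

theorem invTrace_apply (x : A) : W.invTrace x = regTrace x + regTrace (W.S x) := rfl

theorem invTrace_S (x : A) : W.invTrace (W.S x) = W.invTrace x := by
  have h : regTrace (W.S (W.S x)) = regTrace x := regTrace_algEquiv W.SsqEquiv x
  rw [invTrace_apply, invTrace_apply, h, add_comm]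

theorem invTrace_mul_comm (x y : A) : W.invTrace (x * y) = W.invTrace (y * x) := by
  rw [invTrace_apply, invTrace_apply, W.S_antimul, W.S_antimul, regTrace_mul_comm x,
    regTrace_mul_comm (W.S y)]

theorem regTrace_S_star_mul_self_nonneg (x : A) : 0 ≤ regTrace (W.S (star x * x)) :=
  regTrace_nonneg fun μ hμ =>
    spectrum_star_mul_self_nonneg_of_finiteDimensional x μ (W.spectrum_S_subset _ hμ)

theorem regTrace_star_mul_self_nonneg (x : A) : 0 ≤ regTrace (star x * x) :=
  regTrace_nonneg (spectrum_star_mul_self_nonneg_of_finiteDimensional x)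

theorem invTrace_star_mul_self_nonneg (x : A) : 0 ≤ W.invTrace (star x * x) :=
  add_nonneg (regTrace_star_mul_self_nonneg x) (W.regTrace_S_star_mul_self_nonneg x)

theorem eq_zero_of_invTrace {x : A} (h : W.invTrace (star x * x) = 0) : x = 0 :=
  eq_zero_of_regTrace_star_mul_self
    ((add_eq_zero_iff_of_nonneg (regTrace_star_mul_self_nonneg x)
      (W.regTrace_S_star_mul_self_nonneg x)).1 h).1

theorem invTrace_star_mul_Ssq (x y : A) :
    W.invTrace (star x * W.Ssq y) = W.invTrace (star (W.S x) * W.S y) := by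
  rw [← W.S.apply_symm_apply (star x), Ssq_apply, ← W.S_antimul, invTrace_S, invTrace_mul_comm,
    star_S]

theorem invTrace_star_Ssq_mul (x y : A) :
    W.invTrace (star (W.Ssq x) * y) = W.invTrace (star x * W.Ssq y) := by
  rw [← W.invTrace_S, ← W.invTrace_S, W.S_antimul, W.S_antimul, Ssq_apply, star_S, star_S,
    LinearEquiv.apply_symm_apply, LinearEquiv.apply_symm_apply, Ssq_apply]

theorem pos_of_Ssq_eq_smul {x : A} (hx : x ≠ 0) {μ : ℂ} (h : W.Ssq x = μ • x) : 0 < μ := by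
  have hpos : ∀ y : A, y ≠ 0 → 0 < W.invTrace (star y * y) := fun y hy =>
    lt_of_le_of_ne (W.invTrace_star_mul_self_nonneg y) fun h => hy (W.eq_zero_of_invTrace h.symm)
  have h1 := W.invTrace_star_mul_Ssq x x
  rw [h, mul_smul_comm, map_smul, smul_eq_mul] at h1
  have h2 := hpos (W.S x) (by simpa using hx)
  rw [← h1] at h2
  exact pos_of_mul_pos_left h2 (hpos x hx).le

theorem ker_sq_Ssq_sub {μ : ℂ} {x : A} (h : (W.Ssq - μ • (1 : Module.End ℂ A))
    ((W.Ssq - μ • (1 : Module.End ℂ A)) x) = 0) :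
    (W.Ssq - μ • (1 : Module.End ℂ A)) x = 0 := by
  by_contra hx
  have hμ : 0 < μ := W.pos_of_Ssq_eq_smul hx (sub_eq_zero.1 h)
  apply hx
  apply W.eq_zero_of_invTrace
  have hs : star μ = μ := (IsSelfAdjoint.of_nonneg hμ.le).star_eq
  have h1 : ∀ y, W.invTrace (star ((W.Ssq - μ • (1 : Module.End ℂ A)) x) * y)
      = W.invTrace (star x * (W.Ssq - μ • (1 : Module.End ℂ A)) y) := by
    intro y
    have := W.invTrace_star_Ssq_mul x y
    simp only [LinearMap.sub_apply, LinearMap.smul_apply, Module.End.one_apply, star_sub, star_smul,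
      hs, sub_mul, mul_sub, map_sub, this, smul_mul_assoc, mul_smul_comm]
  rw [h1, h, mul_zero, map_zero]

theorem iSup_eigenspace_Ssq : ⨆ μ, W.Ssq.eigenspace μ = ⊤ := by
  rw [← Module.End.iSup_maxGenEigenspace_eq_top W.Ssq]
  refine iSup_congr fun μ => le_antisymm Module.End.eigenspace_le_maxGenEigenspace fun x hx => ?_
  obtain ⟨k, hk⟩ := (Module.End.mem_maxGenEigenspace _ _ _).1 hx
  rw [Module.End.mem_eigenspace_iff, ← sub_eq_zero]
  change (W.Ssq - μ • (1 : Module.End ℂ A)) x = 0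
  induction k with
  | zero => rw [show x = 0 from hk, map_zero]
  | succ k ih =>
    cases k with
    | zero => simpa using hk
    | succ k =>
      apply ih
      rw [pow_succ', pow_succ'] at hk
      rw [pow_succ']
      exact W.ker_sq_Ssq_sub hk

end WeakHopfData

section Polynomial

open Polynomial

variable {M N : Type*} [AddCommGroup M] [Module ℂ M] [AddCommGroup N] [Module ℂ N]

theorem aeval_apply_of_apply_eq_smul {T : Module.End ℂ M} {μ : ℂ} {x : M} (h : T x = μ • x)
    (p : ℂ[X]) : aeval T p x = p.eval μ • x := by
  by_cases hx : x = 0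
  · simp [hx]
  · exact Module.End.aeval_apply_of_hasEigenvector ⟨Module.End.mem_eigenspace_iff.2 h, hx⟩

theorem map_aeval_of_intertwines {T : Module.End ℂ M} {U : Module.End ℂ N} (f : M →ₗ[ℂ] N)
    (h : ∀ x, f (T x) = U (f x)) (p : ℂ[X]) (x : M) : f (aeval T p x) = aeval U p (f x) := by
  have hn : ∀ n : ℕ, f ((T ^ n) x) = (U ^ n) (f x) := by
    intro n
    induction n with
    | zero => rfl
    | succ n ih => rw [pow_succ', pow_succ', Module.End.mul_apply, Module.End.mul_apply, h, ih]
  induction p using Polynomial.induction_on' with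
  | add p q hp hq => simp only [map_add, LinearMap.add_apply, hp, hq]
  | monomial n a => simp [aeval_monomial, Algebra.algebraMap_eq_smul_one, hn]

/-- The inverse square root of a positive real number, as a function on `ℂ`. -/
def invSqrt (μ : ℂ) : ℂ := ((√μ.re)⁻¹ : ℝ)

open ComplexOrder

theorem invSqrt_one : invSqrt 1 = 1 := by simp [invSqrt]

theorem star_invSqrt (μ : ℂ) : star (invSqrt μ) = invSqrt μ := Complex.conj_ofReal _

theorem invSqrt_mul {μ ν : ℂ} (hμ : 0 < μ) : invSqrt (μ * ν) = invSqrt μ * invSqrt ν := by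
  obtain ⟨h1, h2⟩ := Complex.pos_iff.1 hμ
  simp [invSqrt, ← h2, Real.sqrt_mul h1.le, mul_comm]

theorem invSqrt_mul_self {μ : ℂ} (hμ : 0 < μ) : invSqrt μ * invSqrt μ = μ⁻¹ := by
  obtain ⟨h1, h2⟩ := Complex.pos_iff.1 hμ
  have h3 : μ = (μ.re : ℂ) := Complex.ext rfl (by simp [← h2])
  conv_rhs => rw [h3]
  rw [invSqrt, ← Complex.ofReal_mul, ← mul_inv, Real.mul_self_sqrt h1.le, Complex.ofReal_inv]

theorem invSqrt_inv_mul_inv {μ : ℂ} (hμ : 0 < μ) : invSqrt μ⁻¹ * μ⁻¹ = invSqrt μ := by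
  have h : invSqrt μ⁻¹ * invSqrt μ = 1 := by
    rw [← invSqrt_mul (inv_pos.2 hμ), inv_mul_cancel₀ hμ.ne', invSqrt_one]
  rw [← invSqrt_mul_self hμ, ← mul_assoc, invSqrt_mul_self hμ, h, one_mul]

end Polynomial

namespace WeakHopfData

open ComplexOrder Polynomial

variable {A : Type*} [NormedRing A] [StarRing A] [CStarRing A]
  [NormedAlgebra ℂ A] [StarModule ℂ A] [FiniteDimensional ℂ A] (W : WeakHopfData A)

theorem Ssq_eigen_induction {P : A → Prop} (hadd : ∀ x y, P x → P y → P (x + y))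
    (h : ∀ μ x, 0 < μ → W.Ssq.HasEigenvalue μ → W.Ssq x = μ • x → P x) (h0 : P 0) (x : A) :
    P x := by
  have hx : x ∈ ⨆ μ, W.Ssq.eigenspace μ := by rw [W.iSup_eigenspace_Ssq]; trivial
  induction hx using Submodule.iSup_induction' with
  | zero => exact h0
  | add x y _ _ hx hy => exact hadd x y hx hy
  | mem μ x hx =>
    by_cases hx0 : x = 0
    · rwa [hx0]
    · have hx' := Module.End.mem_eigenspace_iff.1 hx
      exact h μ x (W.pos_of_Ssq_eq_smul hx0 hx')
        (Module.End.hasEigenvalue_of_hasEigenvector ⟨hx, hx0⟩) hx'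

theorem exists_invSqrt_polynomial : ∃ p : ℂ[X],
    (∀ μ, W.Ssq.HasEigenvalue μ → p.eval μ = invSqrt μ) ∧
    ∀ μ ν, W.Ssq.HasEigenvalue μ → W.Ssq.HasEigenvalue ν →
      p.eval (μ * ν) = invSqrt (μ * ν) := by
  classical
  let E := (Module.End.finite_spectrum W.Ssq).toFinset
  have hE : ∀ μ, W.Ssq.HasEigenvalue μ → μ ∈ E := fun μ hμ => by
    simpa [E] using Module.End.hasEigenvalue_iff_mem_spectrum.1 hμ
  let s := E ∪ (E ×ˢ E).image fun q => q.1 * q.2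
  have hp : ∀ μ ∈ s, (Lagrange.interpolate s id invSqrt).eval μ = invSqrt μ := fun μ hμ =>
    Lagrange.eval_interpolate_at_node invSqrt Function.injective_id.injOn hμ
  refine ⟨Lagrange.interpolate s id invSqrt, fun μ hμ => hp μ (Finset.mem_union_left _ (hE μ hμ)),
    fun μ ν hμ hν => hp _ (Finset.mem_union_right _ (Finset.mem_image.2
      ⟨(μ, ν), Finset.mem_product.2 ⟨hE μ hμ, hE ν hν⟩, rfl⟩))⟩

/-- A polynomial interpolating `invSqrt` on the eigenvalues of `S²` and their products. -/
def invSqrtPoly : ℂ[X] := W.exists_invSqrt_polynomial.choose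

/-- The inverse square root of `S²`. -/
def SsqInvSqrt : Module.End ℂ A := aeval W.Ssq W.invSqrtPoly

theorem SsqInvSqrt_apply {μ : ℂ} {x : A} (hx : W.Ssq x = μ • x) :
    W.SsqInvSqrt x = invSqrt μ • x := by
  by_cases hx0 : x = 0
  · simp [hx0]
  · rw [SsqInvSqrt, aeval_apply_of_apply_eq_smul hx,
      show W.invSqrtPoly.eval μ = _ from W.exists_invSqrt_polynomial.choose_spec.1 μ
        (Module.End.hasEigenvalue_of_hasEigenvector ⟨Module.End.mem_eigenspace_iff.2 hx, hx0⟩)]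

theorem aeval_map_Ssq : aeval (TensorProduct.map W.Ssq W.Ssq : Module.End ℂ (A ⊗[ℂ] A))
    W.invSqrtPoly = TensorProduct.map W.SsqInvSqrt W.SsqInvSqrt := by
  refine TensorProduct.ext' fun x y => ?_
  induction x using W.Ssq_eigen_induction with
  | h0 => simp
  | hadd x x' hx hx' => simp only [TensorProduct.add_tmul, map_add, hx, hx']
  | h μ x hμ heμ hx =>
    induction y using W.Ssq_eigen_induction with
    | h0 => simp
    | hadd y y' hy hy' => simp only [TensorProduct.tmul_add, map_add, hy, hy']
    | h ν y hν heν hy =>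
      rw [aeval_apply_of_apply_eq_smul (μ := μ * ν)
          (by rw [TensorProduct.map_tmul, hx, hy, TensorProduct.smul_tmul_smul]),
        show W.invSqrtPoly.eval (μ * ν) = _ from
          W.exists_invSqrt_polynomial.choose_spec.2 μ ν heμ heν,
        invSqrt_mul hμ, TensorProduct.map_tmul, W.SsqInvSqrt_apply hx, W.SsqInvSqrt_apply hy,
        TensorProduct.smul_tmul_smul]

theorem SsqInvSqrt_mul (x y : A) :
    W.SsqInvSqrt (x * y) = W.SsqInvSqrt x * W.SsqInvSqrt y := by
  have h := map_aeval_of_intertwines (T := TensorProduct.map W.Ssq W.Ssq) (U := W.Ssq)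
    (LinearMap.mul' ℂ A) (fun u => by
      induction u with
      | zero => simp
      | tmul a b => simp [W.S_antimul]
      | add u v hu hv => simp only [map_add, hu, hv]) W.invSqrtPoly (x ⊗ₜ[ℂ] y)
  rw [aeval_map_Ssq] at h
  exact h.symm

theorem Δ_Ssq (x : A) : W.Δ (W.Ssq x) = TensorProduct.map W.Ssq W.Ssq (W.Δ x) := by
  rw [Ssq_apply, W.S_anticomul, W.S_anticomul]
  induction W.Δ x with
  | zero => simp
  | tmul a b => simp
  | add u v hu hv => simp only [map_add, hu, hv]

theorem Δ_SsqInvSqrt (x : A) :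
    W.Δ (W.SsqInvSqrt x) = TensorProduct.map W.SsqInvSqrt W.SsqInvSqrt (W.Δ x) := by
  rw [← aeval_map_Ssq, SsqInvSqrt, map_aeval_of_intertwines W.Δ W.Δ_Ssq]

theorem S_SsqInvSqrt (x : A) : W.S (W.SsqInvSqrt x) = W.SsqInvSqrt (W.S x) :=
  map_aeval_of_intertwines (T := W.Ssq) (U := W.Ssq) W.S.toLinearMap (fun _ => rfl) _ _

/-- The map `J = S ∘ (S²)^{-1/2}`. -/
def J : A →ₗ[ℂ] A := W.S.toLinearMap ∘ₗ W.SsqInvSqrt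

theorem J_apply (x : A) : W.J x = W.S (W.SsqInvSqrt x) := rfl

theorem J_mul (x y : A) : W.J (x * y) = W.J y * W.J x := by
  simp only [J_apply, SsqInvSqrt_mul, W.S_antimul]

theorem J_J (x : A) : W.J (W.J x) = x := by
  induction x using W.Ssq_eigen_induction with
  | h0 => simp
  | hadd x y hx hy => simp only [map_add, hx, hy]
  | h μ x hμ heμ hx =>
    rw [J_apply, J_apply, ← S_SsqInvSqrt, ← Ssq_apply, W.SsqInvSqrt_apply hx, map_smul,
      W.SsqInvSqrt_apply hx, map_smul, map_smul, hx, smul_smul, smul_smul, invSqrt_mul_self hμ,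
      inv_mul_cancel₀ hμ.ne', one_smul]

theorem J_one : W.J 1 = 1 := by
  simpa [J_J] using (W.J_mul (W.J 1) 1).symm

theorem J_star (x : A) : W.J (star x) = star (W.J x) := by
  induction x using W.Ssq_eigen_induction with
  | h0 => simp
  | hadd x y hx hy => simp only [map_add, star_add, hx, hy]
  | h μ x hμ heμ hx =>
    have hs : star μ = μ := (IsSelfAdjoint.of_nonneg hμ.le).star_eq
    have h1 : W.S (star x) = μ⁻¹ • star (W.S x) := by
      have h := W.S.apply_symm_apply (star (W.S x))
      rw [← star_S, ← Ssq_apply, hx, star_smul, hs, map_smul] at h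
      rw [eq_inv_smul_iff₀ hμ.ne', h]
    have h2 : W.Ssq (star x) = μ⁻¹ • star x := by
      rw [Ssq_apply, h1, map_smul, star_S, LinearEquiv.apply_symm_apply]
    rw [J_apply, J_apply, W.SsqInvSqrt_apply hx, W.SsqInvSqrt_apply h2, map_smul, map_smul, h1,
      star_smul, star_invSqrt, smul_smul, invSqrt_inv_mul_inv hμ]

theorem Δ_J (x : A) :
    W.Δ (W.J x) = TensorProduct.comm ℂ A A (TensorProduct.map W.J W.J (W.Δ x)) := by
  rw [J_apply, W.S_anticomul, Δ_SsqInvSqrt, J, TensorProduct.map_comp]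
  rfl

theorem J_eq_S (h : ∀ x, W.S (W.S x) = x) (x : A) : W.J x = W.S x := by
  rw [J_apply, W.SsqInvSqrt_apply (μ := 1) (by rw [Ssq_apply, h, one_smul]), invSqrt_one,
    one_smul]

end WeakHopfData

/-- **Existence of the duality map `J`** (Proposition `J`).
For every `C*`-weak Hopf algebra `A` there exists a linear map `J : A → A` which is a unital
`*`-algebra antihomomorphism, is anticomultiplicative, and is involutive; moreover `J` can be
chosen so that `J = S` whenever `S ∘ S = id`. -/
theorem WeakHopfData.exists_J {A : Type*} [NormedRing A] [StarRing A] [CStarRing A]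
    [NormedAlgebra ℂ A] [StarModule ℂ A] [FiniteDimensional ℂ A]
    (W : WeakHopfData A) :
    ∃ J : A →ₗ[ℂ] A,
      (∀ x y : A, J (x * y) = J y * J x) ∧
      (∀ x : A, J (star x) = star (J x)) ∧
      J 1 = 1 ∧
      (∀ x : A, W.Δ (J x)
        = (TensorProduct.comm ℂ A A) ((TensorProduct.map J J) (W.Δ x))) ∧
      (∀ x : A, J (J x) = x) ∧
      ((∀ x : A, W.S (W.S x) = x) → ∀ x : A, J x = W.S x) := by
  exact ⟨W.J, W.J_mul, W.J_star, W.J_one, W.Δ_J, W.J_J, W.J_eq_S⟩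

end
end

section
/- For every θ ∈ ℝ, g_L^θ h = g_R^θ h and h g_L^θ = h g_R^θ, where the real powers of the positive invertible elements g_L and g_R are taken via the continuous functional calculus. -/
open scoped TensorProduct

noncomputable section

section

open Polynomial

theorem spectrum_finite_of_isIntegral {K A : Type*} [Field K] [Ring A] [Algebra K A] {a : A}
    (ha : IsIntegral K a) : (spectrum K a).Finite := by
  classical
  nontriviality A
  refine Set.Finite.subset (minpoly K a).roots.toFinset.finite_toSet fun z hz => ?_
  have h := spectrum.subset_polynomial_aeval a (minpoly K a) ⟨z, hz, rfl⟩
  rw [minpoly.aeval, spectrum.zero_eq] at h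
  simpa [minpoly.ne_zero ha] using h

theorem Polynomial.exists_eqOn_of_finite {K : Type*} [Field K] {s : Set K} (hs : s.Finite)
    (f : K → K) : ∃ p : K[X], s.EqOn f p.eval := by
  classical
  refine ⟨Lagrange.interpolate hs.toFinset id f, fun z hz => ?_⟩
  exact (Lagrange.eval_interpolate_at_node f (v := id) (Set.injOn_id _)
    (hs.mem_toFinset.2 hz)).symm

theorem Commute.pow_mul_eq_pow_mul {M : Type*} [Monoid M] {a b h : M} (hab : Commute a b)
    (hh : a * h = b * h) (n : ℕ) : a ^ n * h = b ^ n * h := by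
  induction n with
  | zero => simp
  | succ n ih => rw [pow_succ', mul_assoc, ih, ← mul_assoc, (hab.pow_right n).eq, mul_assoc, hh,
      ← mul_assoc, ← pow_succ]

theorem Commute.aeval_mul_eq_aeval_mul {R A : Type*} [CommSemiring R] [Semiring A] [Algebra R A]
    {a b h : A} (hab : Commute a b) (hh : a * h = b * h) (p : R[X]) :
    aeval a p * h = aeval b p * h := by
  simp only [aeval_eq_sum_range, Finset.sum_mul, smul_mul_assoc, hab.pow_mul_eq_pow_mul hh]

/-- Real powers of two positive elements are given by one common polynomial. -/
theorem CFC.exists_rpow_eq_aeval {A : Type*} [CStarAlgebra A] [PartialOrder A] [StarOrderedRing A]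
    [FiniteDimensional ℂ A] {a b : A} (ha : 0 ≤ a) (hb : 0 ≤ b) (s : ℝ) :
    ∃ p : ℝ[X], a ^ s = aeval a p ∧ b ^ s = aeval b p := by
  have hfin (c : A) : (spectrum ℝ c).Finite := by
    have : FiniteDimensional ℝ A := FiniteDimensional.complexToReal A
    exact spectrum_finite_of_isIntegral (Algebra.IsIntegral.isIntegral c)
  obtain ⟨p, hp⟩ := Polynomial.exists_eqOn_of_finite ((hfin a).union (hfin b)) (fun x => x ^ s)
  refine ⟨p, ?_, ?_⟩
  · rw [CFC.rpow_eq_cfc_real, cfc_congr (hp.mono Set.subset_union_left), cfc_polynomial p a]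
  · rw [CFC.rpow_eq_cfc_real, cfc_congr (hp.mono Set.subset_union_right), cfc_polynomial p b]

/-- If two commuting continuous positive one-parameter groups agree on `h` at time `1`, then they
agree on `h` at all nonnegative times. -/
theorem mul_eq_mul_of_one_parameter_of_nonneg {A : Type*} [CStarAlgebra A] [PartialOrder A]
    [StarOrderedRing A] [FiniteDimensional ℂ A] {b c : ℝ → A} {h : A}
    (hb0 : b 0 = 1) (hc0 : c 0 = 1)
    (hb : ∀ s t, b (s + t) = b s * b t) (hc : ∀ s t, c (s + t) = c s * c t)
    (hb_nonneg : ∀ t, 0 ≤ b t) (hc_nonneg : ∀ t, 0 ≤ c t)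
    (hb_cont : Continuous b) (hc_cont : Continuous c)
    (hcomm : Commute (b 1) (c 1)) (hh : b 1 * h = c 1 * h) {t : ℝ} (ht : 0 ≤ t) :
    b t * h = c t * h := by
  have hpow {f : ℝ → A} (hf0 : f 0 = 1) (hf : ∀ s t, f (s + t) = f s * f t) (n : ℕ) (s : ℝ) :
      f (n * s) = f s ^ n := by
    induction n with
    | zero => simp [hf0]
    | succ n ih => rw [Nat.cast_succ, add_mul, one_mul, hf, ih, pow_succ]
  have hroot {f : ℝ → A} (hf0 : f 0 = 1) (hf : ∀ s t, f (s + t) = f s * f t)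
      (hpos : ∀ t, 0 ≤ f t) {n : ℕ} (hn : 0 < n) : f (n : ℝ)⁻¹ = f 1 ^ (n : ℝ)⁻¹ := by
    have hn' : (n : ℝ) ≠ 0 := by positivity
    have h1 : f 1 = f (n : ℝ)⁻¹ ^ (n : ℝ) := by
      rw [CFC.rpow_natCast _ n (hpos _), ← hpow hf0 hf, mul_inv_cancel₀ hn']
    rw [h1, CFC.rpow_rpow_of_exponent_nonneg _ _ _ (by positivity) (by positivity) (hpos _),
      mul_inv_cancel₀ hn', CFC.rpow_one _ (hpos _)]
  have hfrac : ∀ k n : ℕ, 0 < n → b ((k : ℝ) / n) * h = c ((k : ℝ) / n) * h := by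
    intro k n hn
    obtain ⟨p, hp, hq⟩ := CFC.exists_rpow_eq_aeval (hb_nonneg 1) (hc_nonneg 1) (n : ℝ)⁻¹
    rw [div_eq_mul_inv, hpow hb0 hb, hpow hc0 hc, hroot hb0 hb hb_nonneg hn,
      hroot hc0 hc hc_nonneg hn, hp, hq, ← map_pow, ← map_pow]
    exact hcomm.aeval_mul_eq_aeval_mul hh _
  have hlim : Filter.Tendsto (fun n : ℕ => ((⌊t * n⌋₊ : ℕ) : ℝ) / n) Filter.atTop (nhds t) :=
    (tendsto_nat_floor_mul_div_atTop ht).comp tendsto_natCast_atTop_atTop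
  refine tendsto_nhds_unique (((hb_cont.tendsto t).comp hlim).mul_const h)
    ((((hc_cont.tendsto t).comp hlim).mul_const h).congr' ?_)
  filter_upwards [Filter.eventually_gt_atTop 0] with n hn
  exact (hfrac _ n hn).symm

/-- If two commuting continuous positive one-parameter groups agree on `h` at time `1`, then they
agree on `h` at all times. -/
theorem mul_eq_mul_of_one_parameter {A : Type*} [CStarAlgebra A] [PartialOrder A]
    [StarOrderedRing A] [FiniteDimensional ℂ A] {b c : ℝ → A} {h : A}
    (hb0 : b 0 = 1) (hc0 : c 0 = 1)
    (hb : ∀ s t, b (s + t) = b s * b t) (hc : ∀ s t, c (s + t) = c s * c t)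
    (hb_nonneg : ∀ t, 0 ≤ b t) (hc_nonneg : ∀ t, 0 ≤ c t)
    (hb_cont : Continuous b) (hc_cont : Continuous c)
    (hcomm : Commute (b 1) (c 1)) (hh : b 1 * h = c 1 * h) (t : ℝ) :
    b t * h = c t * h := by
  rcases le_total 0 t with ht | ht
  · exact mul_eq_mul_of_one_parameter_of_nonneg hb0 hc0 hb hc hb_nonneg hc_nonneg hb_cont hc_cont
      hcomm hh ht
  have exists_unit {f : ℝ → A} (hf0 : f 0 = 1) (hf : ∀ s t, f (s + t) = f s * f t) :
      ∃ u : Aˣ, (u : A) = f 1 ∧ ((u⁻¹ : Aˣ) : A) = f (-1) :=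
    ⟨⟨f 1, f (-1), by rw [← hf, add_neg_cancel, hf0], by rw [← hf, neg_add_cancel, hf0]⟩, rfl, rfl⟩
  obtain ⟨u, hu, hu'⟩ := exists_unit hb0 hb
  obtain ⟨v, hv, hv'⟩ := exists_unit hc0 hc
  rw [← hu, ← hv] at hcomm hh
  have hcomm' : Commute (b (-1)) (c (-1)) := by
    rw [← hu', ← hv']
    exact hcomm.units_inv_left.units_inv_right
  have hh' : b (-1) * h = c (-1) * h := by
    rw [← hu', ← hv', Units.inv_mul_eq_iff_eq_mul, ← mul_assoc,
      hcomm.units_inv_right.eq, mul_assoc, hh, Units.inv_mul_cancel_left]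
  have key := mul_eq_mul_of_one_parameter_of_nonneg (b := fun s => b (-s)) (c := fun s => c (-s))
    (h := h) (by simpa using hb0) (by simpa using hc0)
    (fun s t => by rw [neg_add, hb]) (fun s t => by rw [neg_add, hc])
    (fun s => hb_nonneg _) (fun s => hc_nonneg _) (hb_cont.comp continuous_neg)
    (hc_cont.comp continuous_neg) hcomm' hh' (neg_nonneg.2 ht)
  simpa only [neg_neg] using key

end

namespace WeakHopfData

variable {A : Type*} [NormedRing A] [NormedAlgebra ℂ A]

/-- Contract the last leg of a threefold tensor with a linear functional. -/
def contractLast (φ : A →ₗ[ℂ] ℂ) : (A ⊗[ℂ] A) ⊗[ℂ] A →ₗ[ℂ] A ⊗[ℂ] A :=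
  (TensorProduct.rid ℂ (A ⊗[ℂ] A)).toLinearMap ∘ₗ TensorProduct.map LinearMap.id φ

theorem contractLast_map_id (f : A →ₗ[ℂ] A ⊗[ℂ] A) (φ : A →ₗ[ℂ] ℂ) (t : A ⊗[ℂ] A) :
    contractLast φ (TensorProduct.map f LinearMap.id t) = f (rapp φ t) := by
  induction t with
  | zero => simp
  | tmul a b => simp [contractLast, rapp]
  | add u v hu hv => simp only [map_add, hu, hv]

theorem contractLast_assoc_symm_mul (φ : A →ₗ[ℂ] ℂ) (t u : A ⊗[ℂ] A) :
    contractLast φ ((TensorProduct.assoc ℂ A A A).symm ((1 : A) ⊗ₜ[ℂ] t) * (u ⊗ₜ[ℂ] (1 : A)))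
      = ((1 : A) ⊗ₜ[ℂ] rapp φ t) * u := by
  induction t with
  | zero => simp
  | tmul a b => simp [contractLast, rapp, TensorProduct.tmul_smul]
  | add v w hv hw => simp only [TensorProduct.tmul_add, map_add, add_mul, hv, hw]

variable [StarRing A] [CStarRing A] [StarModule ℂ A] [FiniteDimensional ℂ A]

theorem εL_one_s4 (W : WeakHopfData A) : W.εL 1 = 1 := by
  have h := W.antipode_left 1
  rw [LinearMap.mulRight_one, LinearMap.comp_id] at h
  exact h.trans (LinearMap.congr_fun W.counit_left 1)

theorem comul_εR (W : WeakHopfData A) (x : A) :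
    W.Δ (W.εR x) = ((1 : A) ⊗ₜ[ℂ] W.εR x) * W.Δ 1 := by
  have h : W.εR x = rapp (W.ε ∘ₗ LinearMap.mulLeft ℂ x) (W.Δ 1) := W.antipode_right x
  rw [h, ← contractLast_map_id, W.Δ_one_weak', contractLast_assoc_symm_mul]

/-- On the target subalgebra the source counital map agrees with the antipode. -/
theorem εL_εR (W : WeakHopfData A) (x : A) : W.εL (W.εR x) = W.S (W.εR x) := by
  have key : ∀ (r : A) (u : A ⊗[ℂ] A),
      LinearMap.mul' ℂ A (TensorProduct.map LinearMap.id W.S.toLinearMap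
        (((1 : A) ⊗ₜ[ℂ] r) * u)) =
      LinearMap.mul' ℂ A (TensorProduct.map LinearMap.id W.S.toLinearMap u) * W.S r := by
    intro r u
    induction u with
    | zero => simp
    | tmul a b => simp [W.S_antimul, mul_assoc]
    | add v w hv hw => simp only [mul_add, add_mul, map_add, hv, hw]
  change LinearMap.mul' ℂ A (TensorProduct.map LinearMap.id W.S.toLinearMap (W.Δ (W.εR x))) = _
  rw [W.comul_εR, key]
  change W.εL 1 * _ = _
  rw [W.εL_one_s4, one_mul]

end WeakHopfData

theorem HaarPkg.gL_mul_haar {A : Type*} [NormedRing A] [StarRing A] [CStarRing A]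
    [NormedAlgebra ℂ A] [StarModule ℂ A] [FiniteDimensional ℂ A] (P : HaarPkg A) :
    P.gL * P.h = P.gR * P.h := by
  have hS : P.W.S P.gR = P.gL := by
    have hc : Commute P.gL (P.gL * Ring.inverse P.gR) := by
      obtain ⟨u, hu⟩ := P.gR_unit
      have hc : Commute P.gL u := hu ▸ P.gLR_comm
      rw [← hu, Ring.inverse_unit]
      exact (Commute.refl P.gL).mul_right hc.units_inv_right
    rw [P.gR_S, P.S_sq, ← hc.eq, mul_assoc, Ring.mul_inverse_cancel _ P.g_unit, mul_one]
  obtain ⟨x, hx⟩ := P.gR_mem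
  rw [P.haar_left P.gR, ← hx, P.W.εL_εR, hx, hS]

/-- For every `θ ∈ ℝ`, `gL^θ h = gR^θ h` and `h gL^θ = h gR^θ`. -/
theorem HaarPkg.gpow_mul_haar {A : Type*} [NormedRing A] [StarRing A] [CStarRing A]
    [NormedAlgebra ℂ A] [StarModule ℂ A] [FiniteDimensional ℂ A]
    (P : HaarPkg A) (θ : ℝ) :
    P.gLpow θ * P.h = P.gRpow θ * P.h ∧ P.h * P.gLpow θ = P.h * P.gRpow θ := by
  let _ : CStarAlgebra A := { (inferInstance : NormedRing A), (inferInstance : StarRing A),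
    (inferInstance : CStarRing A), (inferInstance : NormedAlgebra ℂ A),
    (inferInstance : StarModule ℂ A) with
    toCompleteSpace := FiniteDimensional.complete ℂ A }
  let _ := CStarAlgebra.spectralOrder A
  let _ := CStarAlgebra.spectralOrderedRing A
  have nonneg {x : A} (hx : IsPosElem x) : 0 ≤ x := CStarAlgebra.nonneg_iff_eq_star_mul_self.2 hx
  have star_eq {x : A} (hx : IsPosElem x) : star x = x := (nonneg hx).isSelfAdjoint.star_eq
  have key : P.gLpow θ * P.h = P.gRpow θ * P.h :=
    mul_eq_mul_of_one_parameter P.gLpow_zero P.gRpow_zero P.gLpow_add P.gRpow_add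
      (fun t => nonneg (P.gLpow_pos t)) (fun t => nonneg (P.gRpow_pos t))
      P.gLpow_continuous P.gRpow_continuous
      (by rw [P.gLpow_one, P.gRpow_one]; exact P.gLR_comm)
      (by rw [P.gLpow_one, P.gRpow_one]; exact P.gL_mul_haar) θ
  refine ⟨key, ?_⟩
  simpa only [star_mul, P.haar_star, star_eq (P.gLpow_pos θ), star_eq (P.gRpow_pos θ)]
    using congrArg star key

end
end
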